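/- arXiv:1809.10957 — 3 statements merged into one kernel-verified Lean document; each statement's English description precedes it below -/
import Mathlib

section
/- Suppose the finite p-group G has a self-centralizing normal cyclic subgroup A. If a faithful 𝕂G-irrep ψ overlaps with a faithful 𝕂A-irrep ξ, then ind_A^G(ξ) is isomorphic to a direct sum of copies of ψ. Moreover, the overlap relation defines a bijection between the set of isomorphism classes of faithful 𝕂G-irreps and the set of G-conjugacy classes of faithful 𝕂A-irreps. -/
open scoped Classical

noncomputable section

namespace Genotype

variable {k : Type} [Field k] {G : Type} [Group G]

/-- The subfield generated (over the prime field `ℚ`) by the values of a function,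
e.g. the field `ℚ[ψ]` generated by the values of a character. -/
def charField {X : Type} {k : Type} [Field k] (f : X → k) : Subfield k :=
  Subfield.closure (Set.range f)

theorem mem_charField {X : Type} {k : Type} [Field k] (f : X → k) (x : X) :
    f x ∈ charField f :=
  Subfield.subset_closure ⟨x, rfl⟩

/-- Two functions (typically characters of irreps over possibly different
characteristic-zero fields) are Galois conjugate: there is a Galois extension `M` of `ℚ`
containing (copies of) all their values and a field automorphism `α` of `M` with
`α (f g) = f' g` for all `g`. -/
def IsGaloisConj {k l : Type} [Field k] [Field l] {G : Type}
    (f : G → k) (f' : G → l) : Prop :=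
  ∃ (M : Type) (_ : Field M) (_ : Algebra ℚ M), IsGalois ℚ M ∧
    ∃ (i : charField f →+* M) (j : charField f' →+* M) (α : M ≃+* M),
      ∀ g : G, α (i ⟨f g, mem_charField f g⟩) = j ⟨f' g, mem_charField f' g⟩

/-- Irreducibility of a finite-dimensional representation. -/
def IsIrr (V : FDRep k G) : Prop :=
  Nontrivial V ∧
    ∀ U : Submodule k V, (∀ g : G, ∀ x ∈ U, V.ρ g x ∈ U) → U = ⊥ ∨ U = ⊤

/-- Faithfulness of a representation. -/
def IsFaithfulRep (V : FDRep k G) : Prop := Function.Injective V.ρ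

/-- `f` (the character of an irrep) occurs in the character `c`,
i.e. `c = f + (character of some representation)`. -/
def CharOccurs (f c : G → k) : Prop :=
  ∃ W : FDRep k G, c = f + W.character

/-- `f` (the character of an irrep) occurs in `c` with multiplicity exactly `m`. -/
def CharMult (f c : G → k) (m : ℕ) : Prop :=
  ∃ W : FDRep k G, c = m • f + W.character ∧ ¬ CharOccurs f W.character

/-- `f` is the character of an irreducible representation. -/
def IsIrrChar (f : G → k) : Prop := ∃ V : FDRep k G, IsIrr V ∧ f = V.character

/-- Restriction of a character to a subgroup. -/
def resChar (H : Subgroup G) (c : G → k) : H → k := fun h => c h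

/-- The induced character `ind_H^G f`. -/
def indChar (H : Subgroup G) (f : H → k) : G → k := fun g =>
  (Nat.card H : k)⁻¹ *
    ∑ᶠ x : G, if h : x⁻¹ * g * x ∈ H then f ⟨x⁻¹ * g * x, h⟩ else 0

/-- The character `cψ` (of a `kG`-irrep) is tightly induced from the character `cφ`
(of a `kH`-irrep): `cψ` is the induced character of `cφ`, `cφ` occurs with multiplicity
exactly `1` in the restriction of `cψ`, and no Galois conjugate of `cφ` other than `cφ`
itself occurs in the restriction of `cψ`. -/
def TightInd (H : Subgroup G) (cψ : G → k) (cφ : H → k) : Prop :=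
  cψ = indChar H cφ ∧ CharMult cφ (resChar H cψ) 1 ∧
    ∀ cφ' : H → k, IsIrrChar cφ' → IsGaloisConj cφ cφ' →
      CharOccurs cφ' (resChar H cψ) → cφ' = cφ

/-- Tight induction from a subquotient `H/K` of `G`: tight induction from `H`
of the inflation. -/
def TightIndSub (H : Subgroup G) (K : Subgroup H) [K.Normal]
    (cψ : G → k) (cφ : (H ⧸ K) → k) : Prop :=
  TightInd H cψ (fun h => cφ (QuotientGroup.mk h))

/-- A group is Roquette if every normal abelian subgroup of it is cyclic. -/
def IsRoquette (P : Type) [Group P] : Prop :=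
  ∀ A : Subgroup P, A.Normal → (∀ x ∈ A, ∀ y ∈ A, x * y = y * x) → IsCyclic A

/-- `χ` is the rational form `ψ_ℚ` of `V`: a rational irrep such that `V` occurs in the
scalar extension `k ⊗_ℚ χ`. -/
def IsRatForm [CharZero k] (χ : FDRep ℚ G) (V : FDRep k G) : Prop :=
  IsIrr χ ∧ CharOccurs V.character (fun g => algebraMap ℚ k (χ.character g))

/-- Irreps over possibly different characteristic-zero fields are quasiconjugate if they
determine the same rational irrep. -/
def Quasiconj {k l : Type} [Field k] [Field l] [CharZero k] [CharZero l] {G : Type} [Group G]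
    (V : FDRep k G) (W : FDRep l G) : Prop :=
  ∃ χ : FDRep ℚ G, IsRatForm χ V ∧ IsRatForm χ W

end Genotype

namespace Genotype

/-- The `g`-conjugate of a character `f` of a normal subgroup `A ⊴ G`. -/
def conjSubChar {k G : Type} [Field k] [Group G] (A : Subgroup G) (hA : A.Normal)
    (g : G) (f : A → k) : A → k := fun a =>
  f ⟨g⁻¹ * a * g, by simpa using hA.conj_mem (a : G) a.2 g⁻¹⟩

section helpers
set_option linter.unusedSectionVars false
open Representation Module

def IrrR {k H V : Type} [Field k] [Group H] [AddCommGroup V] [Module k V]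
    (ρ : Representation k H V) : Prop :=
  Nontrivial V ∧ ∀ U : Submodule k V, (∀ g : H, ∀ x ∈ U, ρ g x ∈ U) → U = ⊥ ∨ U = ⊤

def pr {k H : Type} [Field k] [Group H] [Fintype H] (f c : H → k) : k := ∑ h, f h⁻¹ * c h

def Inter {k H V W : Type} [Field k] [Group H] [AddCommGroup V] [Module k V] [AddCommGroup W]
    [Module k W] (ρ : Representation k H V) (σ : Representation k H W) : Prop :=
  ∃ f : V →ₗ[k] W, f ≠ 0 ∧ ∀ h v, f (ρ h v) = σ h (f v)

variable {k H V W : Type} [Field k] [CharZero k] [Group H] [Fintype H]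
  [AddCommGroup V] [Module k V] [FiniteDimensional k V]
  [AddCommGroup W] [Module k W] [FiniteDimensional k W]

theorem mem_inv (ρ : Representation k H V) (σ : Representation k H W) (f : V →ₗ[k] W) :
    f ∈ (linHom ρ σ).invariants ↔ ∀ h v, f (ρ h v) = σ h (f v) := by
  rw [mem_invariants]
  have := mem_linHom_invariants_iff_isIntertwining (ρ := ρ) (σ := σ) f
  constructor
  · intro h
    exact (this.1 h).1
  · intro h
    exact this.2 ⟨h⟩

theorem card_ne : (Nat.card H : k) ≠ 0 := by
  exact_mod_cast Nat.card_pos.ne'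

theorem pair (ρ : Representation k H V) (σ : Representation k H W) :
    pr ρ.character σ.character = (Nat.card H : k) * finrank k (linHom ρ σ).invariants := by
  have : Invertible (Nat.card H : k) := invertibleOfNonzero card_ne
  rw [← card_inv_mul_sum_char_eq_finrank, mul_inv_cancel_left₀ card_ne]
  simp [pr]

theorem pr_ne_iff (ρ : Representation k H V) (σ : Representation k H W) :
    pr ρ.character σ.character ≠ 0 ↔ Inter ρ σ := by
  rw [pair, mul_ne_zero_iff, and_iff_right card_ne, Nat.cast_ne_zero, ne_eq,
    Submodule.finrank_eq_zero, ← ne_eq, Submodule.ne_bot_iff]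
  simp only [mem_inv]
  exact ⟨fun ⟨f, h, h'⟩ => ⟨f, h', h⟩, fun ⟨f, h, h'⟩ => ⟨f, h', h⟩⟩

theorem pr_comm (f c : H → k) : pr f c = pr c f := by
  unfold pr
  rw [← Equiv.sum_comp (Equiv.inv H)]
  simp [mul_comm]

theorem pr_add_left (f f' c : H → k) : pr (f + f') c = pr f c + pr f' c := by
  simp [pr, add_mul, Finset.sum_add_distrib]

theorem pr_add_right (f c c' : H → k) : pr f (c + c') = pr f c + pr f c' := by
  simp [pr, mul_add, Finset.sum_add_distrib]

theorem split (σ : Representation k H W) (U : Submodule k W) (hU : ∀ g, ∀ x ∈ U, σ g x ∈ U) :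
    ∃ (U' : Submodule k W) (τ : Representation k H U) (τ' : Representation k H U'),
      IsCompl U U' ∧ (∀ h x, (τ h x : W) = σ h x) ∧
      σ.character = τ.character + τ'.character := by
  have : NeZero (Nat.card H : k) := ⟨card_ne⟩
  let S : Subrepresentation σ := ⟨U, fun g x hx => hU g x hx⟩
  obtain ⟨S', hS'⟩ := exists_isCompl S
  have hc : IsCompl U S'.toSubmodule := by
    constructor
    · rw [disjoint_iff]
      have := disjoint_iff.1 hS'.1
      exact congrArg Subrepresentation.toSubmodule this
    · rw [codisjoint_iff]
      have := codisjoint_iff.1 hS'.2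
      exact congrArg Subrepresentation.toSubmodule this
  refine ⟨S'.toSubmodule, S.toRepresentation, S'.toRepresentation, hc, fun h x => rfl, ?_⟩
  ext h
  simp only [character, Pi.add_apply]
  rw [← LinearMap.trace_prodMap', ← LinearMap.trace_conj' _ (Submodule.prodEquivOfIsCompl _ _ hc)]
  congr 1
  ext x
  obtain ⟨y, rfl⟩ := (Submodule.prodEquivOfIsCompl _ _ hc).surjective x
  simp [LinearEquiv.conj_apply]
  rfl

theorem inter_inj {ρ : Representation k H V} {σ : Representation k H W} (hρ : IrrR ρ)
    (f : V →ₗ[k] W) (hf : f ≠ 0) (hi : ∀ h v, f (ρ h v) = σ h (f v)) : Function.Injective f := by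
  rw [← LinearMap.ker_eq_bot]
  refine (hρ.2 (LinearMap.ker f) ?_).resolve_right ?_
  · intro g x hx
    rw [LinearMap.mem_ker] at *
    rw [hi, hx, map_zero]
  · rwa [LinearMap.ker_eq_top]

theorem inter_surj {ρ : Representation k H V} {σ : Representation k H W} (hσ : IrrR σ)
    (f : V →ₗ[k] W) (hf : f ≠ 0) (hi : ∀ h v, f (ρ h v) = σ h (f v)) : Function.Surjective f := by
  rw [← LinearMap.range_eq_top]
  refine (hσ.2 (LinearMap.range f) ?_).resolve_left ?_
  · rintro g _ ⟨x, rfl⟩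
    exact ⟨ρ g x, hi g x⟩
  · rwa [LinearMap.range_eq_bot]

theorem char_eq_of_bij {ρ : Representation k H V} {σ : Representation k H W}
    (f : V →ₗ[k] W) (hb : Function.Bijective f) (hi : ∀ h v, f (ρ h v) = σ h (f v)) :
    ρ.character = σ.character := by
  let e := LinearEquiv.ofBijective f hb
  ext h
  simp only [character]
  rw [← LinearMap.trace_conj' _ e]
  congr 1
  ext x
  obtain ⟨y, rfl⟩ := e.surjective x
  simp [LinearEquiv.conj_apply, e, hi]

theorem irr_of (V : FDRep k H) : IsIrr V ↔ IrrR V.ρ := Iff.rfl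

theorem occurs_iff (ρ : Representation k H V) (hρ : IrrR ρ) (σ : Representation k H W) :
    CharOccurs ρ.character σ.character ↔ Inter ρ σ := by
  constructor
  · rintro ⟨X, hX⟩
    have hX' : σ.character = ρ.character + Representation.character X.ρ := hX
    rw [← pr_ne_iff, hX', pr_add_right, pair, pair, ← mul_add]
    refine mul_ne_zero card_ne ?_
    have : 0 < finrank k (linHom ρ ρ).invariants := by
      rw [Nat.pos_iff_ne_zero, ne_eq, Submodule.finrank_eq_zero, ← ne_eq, Submodule.ne_bot_iff]
      have := hρ.1
      refine ⟨LinearMap.id, (mem_inv _ _ _).2 fun _ _ => rfl, ?_⟩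
      intro h
      obtain ⟨x, hx⟩ := exists_ne (0 : V)
      exact hx (LinearMap.congr_fun h x)
    norm_cast
    omega
  · rintro ⟨f, hf, hi⟩
    obtain ⟨U', τ, τ', hc, hτ, he⟩ := split σ (LinearMap.range f) (by
      rintro g _ ⟨x, rfl⟩
      exact ⟨ρ g x, hi g x⟩)
    refine ⟨FDRep.of τ', ?_⟩
    rw [he]
    have : ρ.character = τ.character := by
      refine char_eq_of_bij f.rangeRestrict ⟨?_, LinearMap.surjective_rangeRestrict f⟩ ?_
      · rw [← LinearMap.ker_eq_bot, LinearMap.ker_rangeRestrict, LinearMap.ker_eq_bot]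
        exact inter_inj hρ f hf hi
      · intro h v
        apply Subtype.ext
        rw [hτ]
        exact hi h v
    rw [this]
    rfl

theorem decomp_aux (n : ℕ) : ∀ (W : Type) [AddCommGroup W] [Module k W] [FiniteDimensional k W]
    (σ : Representation k H W), finrank k W ≤ n →
    ∃ s : List (FDRep k H), (∀ X ∈ s, IsIrr X) ∧ σ.character = (s.map FDRep.character).sum := by
  induction n with
  | zero =>
    intro W _ _ _ σ hn
    refine ⟨[], by simp, ?_⟩
    have : Subsingleton W := finrank_zero_iff.1 (Nat.le_zero.1 hn)
    ext h
    simp only [character]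
    rw [Subsingleton.elim (σ h) 0]
    simp
  | succ n ih =>
    intro W _ _ _ σ hn
    by_cases hi : IrrR σ
    · exact ⟨[FDRep.of σ], by simp only [List.mem_singleton, forall_eq]; exact hi, by simp; rfl⟩
    · by_cases hW : Nontrivial W
      · unfold IrrR at hi
        push Not at hi
        obtain ⟨U, hU, hb, ht⟩ := hi hW
        obtain ⟨U', τ, τ', hc, hτ, he⟩ := split σ U hU
        have h1 := Submodule.finrank_add_eq_of_isCompl hc
        have h2 := Submodule.finrank_lt ht
        have h3 : finrank k U ≠ 0 := by rwa [ne_eq, Submodule.finrank_eq_zero]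
        obtain ⟨s, hs, hs'⟩ := ih U τ (by omega)
        obtain ⟨t, ht, ht'⟩ := ih U' τ' (by omega)
        refine ⟨s ++ t, ?_, ?_⟩
        · intro X hX
          rcases List.mem_append.1 hX with h | h
          exacts [hs X h, ht X h]
        · rw [he, hs', ht']; simp
      · rw [not_nontrivial_iff_subsingleton] at hW
        exact ih W σ (by rw [finrank_zero_of_subsingleton]; omega)

theorem decomp (σ : Representation k H W) :
    ∃ s : List (FDRep k H), (∀ X ∈ s, IsIrr X) ∧ σ.character = (s.map FDRep.character).sum :=
  decomp_aux _ W σ le_rfl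

theorem pr_list (f : H → k) (s : List (H → k)) : pr f s.sum = (s.map (pr f)).sum := by
  induction s with
  | nil => simp [pr]
  | cons a s ih => simp [pr_add_right, ih]


variable {G : Type} [Group G] [Fintype G]

theorem normal_of_le_cyclic (A : Subgroup G) (hAn : A.Normal) (hAc : IsCyclic A)
    (N : Subgroup G) (hN : N ≤ A) : N.Normal := by
  constructor
  intro n hn g
  obtain ⟨m, hm⟩ := MonoidHom.map_cyclic ((MulAut.conjNormal g : MulAut A).toMonoidHom)
  have := congrArg Subtype.val (hm ⟨n, hN hn⟩)
  simp at this
  rw [this]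
  exact N.zpow_mem hn m

theorem fix_zero {ρ : Representation k G V} (hρ : IrrR ρ) (hf : Function.Injective ρ)
    (N : Subgroup G) (hN : N.Normal) (hb : N ≠ ⊥) (v : V) (hv : ∀ n ∈ N, ρ n v = v) : v = 0 := by
  let U : Submodule k V :=
    { carrier := {v | ∀ n ∈ N, ρ n v = v}
      add_mem' := by
        intro a b ha hb n hn
        rw [map_add, ha n hn, hb n hn]
      zero_mem' := by intro n _; simp
      smul_mem' := by
        intro c a ha n hn
        rw [map_smul, ha n hn] }
  rcases hρ.2 U (by
    intro g x hx n hn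
    have h1 := hx (g⁻¹ * n * g) (by simpa using hN.conj_mem n hn g⁻¹)
    have : ρ n (ρ g x) = ρ g (ρ (g⁻¹ * n * g) x) := by
      rw [← Module.End.mul_apply, ← Module.End.mul_apply, ← map_mul, ← map_mul]
      congr 2
      group
    rw [this, h1]) with h | h
  · have : v ∈ U := hv
    rw [h] at this
    exact (Submodule.mem_bot k).1 this
  · exfalso
    apply hb
    rw [Subgroup.eq_bot_iff_forall]
    intro n hn
    apply hf
    ext x
    have : x ∈ U := h ▸ Submodule.mem_top
    rw [this n hn]
    simp

theorem char_vanish (A : Subgroup G) (hAn : A.Normal) (hAc : IsCyclic A)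
    (hsc : Subgroup.centralizer (A : Set G) = A) {ρ : Representation k G V} (hρ : IrrR ρ)
    (hf : Function.Injective ρ) (g : G) (hg : g ∉ A) : ρ.character g = 0 := by
  let _ : CommGroup A := hAc.commGroup
  let φ : A →* A := (MonoidHom.id A) / (MulAut.conjNormal g : MulAut A).toMonoidHom
  have hφ : ∀ a : A, ((φ a : A) : G) = a * (g * (a : G)⁻¹ * g⁻¹) := by
    intro a
    have : φ a = a * (MulAut.conjNormal g a)⁻¹ := by
      simp [φ, div_eq_mul_inv]
    rw [this]
    simp [mul_assoc]
  let N : Subgroup G := φ.range.map A.subtype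
  have hN : N.Normal := normal_of_le_cyclic A hAn hAc N (by
    rintro _ ⟨x, _, rfl⟩
    exact x.2)
  have hmem : ∀ x, x ∈ N ↔ ∃ a : A, ((φ a : A) : G) = x := by
    intro x
    constructor
    · rintro ⟨_, ⟨a, rfl⟩, rfl⟩
      exact ⟨a, rfl⟩
    · rintro ⟨a, rfl⟩
      exact ⟨_, ⟨a, rfl⟩, rfl⟩
  have hNb : N ≠ ⊥ := by
    intro hb
    apply hg
    rw [← hsc, Subgroup.mem_centralizer_iff]
    intro a ha
    have h1 : ((φ ⟨a, ha⟩ : A) : G) ∈ N := (hmem _).2 ⟨_, rfl⟩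
    rw [hb, Subgroup.mem_bot, hφ] at h1
    simp only at h1
    have h2 : a * g = (a * (g * a⁻¹ * g⁻¹)) * (g * a) := by group
    rw [h2, h1, one_mul]
  have hE : ∑ a : A, ρ ((φ a : A) : G) = 0 := by
    ext v
    refine fix_zero hρ hf N hN hNb _ ?_
    intro n hn
    obtain ⟨b, rfl⟩ := (hmem n).1 hn
    rw [← Module.End.mul_apply, Finset.mul_sum]
    congr 1
    rw [← Equiv.sum_comp (Equiv.mulLeft b) (fun a : A => ρ ((φ a : A) : G))]
    refine Finset.sum_congr rfl fun a _ => ?_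
    simp only [Equiv.coe_mulLeft, map_mul, Subgroup.coe_mul]
  have h1 : ∀ a : A, ρ.character g = LinearMap.trace k V (ρ ((φ a : A) : G) * ρ g) := by
    intro a
    rw [← char_conj ρ g a, character, hφ, ← map_mul]
    congr 2
    group
  have h2 : (Nat.card A : k) * ρ.character g = 0 := by
    calc (Nat.card A : k) * ρ.character g = ∑ a : A, ρ.character g := by simp
      _ = ∑ a : A, LinearMap.trace k V (ρ ((φ a : A) : G) * ρ g) :=
        Finset.sum_congr rfl fun a _ => h1 a
      _ = 0 := by rw [← map_sum, ← Finset.sum_mul, hE]; simp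
  exact (mul_eq_zero.1 h2).resolve_left card_ne

theorem pr_res (A : Subgroup G) (f c : G → k) (hc : ∀ g, g ∉ A → c g = 0) :
    pr f c = pr (resChar A f) (resChar A c) := by
  unfold pr resChar
  rw [← Finset.sum_subset (Finset.subset_univ (Finset.univ.filter (· ∈ A)))]
  · rw [← Finset.sum_subtype_eq_sum_filter]
    refine Finset.sum_bij (fun x _ => ⟨x.1, by simpa using x.2⟩) ?_ ?_ ?_ ?_ <;> simp
  · intro x _ hx
    rw [hc x (by simpa using hx), mul_zero]

theorem clifford (A : Subgroup G) (hAn : A.Normal) {X : Type} [AddCommGroup X] [Module k X]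
    [FiniteDimensional k X]
    {ρ : Representation k G X} (hρ : IrrR ρ) {σ : Representation k A V} {τ : Representation k A W}
    (hσ : IrrR σ) (hτ : IrrR τ) (h1 : Inter σ (ρ.comp A.subtype)) (h2 : Inter τ (ρ.comp A.subtype)) :
    ∃ g : G, τ.character = conjSubChar A hAn g σ.character := by
  rw [← pr_ne_iff, pr_comm, pr_ne_iff] at h2
  obtain ⟨f, hf, hfi⟩ := h1
  obtain ⟨h, hh, hhi⟩ := h2
  have key : ∃ g : G, h ∘ₗ ρ g ∘ₗ f ≠ 0 := by
    by_contra hcon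
    push Not at hcon
    let U : Submodule k X := ⨅ g : G, LinearMap.ker (h ∘ₗ ρ g)
    have hU : ∀ x, x ∈ U ↔ ∀ g, h (ρ g x) = 0 := by
      intro x
      simp [U, Submodule.mem_iInf]
    rcases hρ.2 U (by
      intro g x hx
      rw [hU] at *
      intro g'
      rw [← Module.End.mul_apply, ← map_mul]
      exact hx _) with h0 | h0
    · apply hf
      ext x
      have : f x ∈ U := by
        rw [hU]
        intro g
        exact LinearMap.congr_fun (hcon g) x
      rw [h0] at this
      exact (Submodule.mem_bot k).1 this
    · apply hh
      ext x
      have : x ∈ U := h0 ▸ Submodule.mem_top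
      have := (hU x).1 this 1
      simpa using this
  obtain ⟨g, hg⟩ := key
  refine ⟨g, ?_⟩
  let c : A →* A := (MulAut.conjNormal g⁻¹ : MulAut A).toMonoidHom
  let σ' : Representation k A V := σ.comp c
  have hi : ∀ (a : A) v, (h ∘ₗ ρ g ∘ₗ f) (σ' a v) = τ a ((h ∘ₗ ρ g ∘ₗ f) v) := by
    intro a v
    have e1 : f (σ' a v) = ρ (g⁻¹ * a * g) (f v) := by
      have := hfi (c a) v
      simp [c] at this
      simpa [σ', c] using this
    simp only [LinearMap.comp_apply]
    rw [e1, ← hhi]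
    congr 1
    simp only [MonoidHom.comp_apply, Subgroup.subtype_apply]
    rw [← Module.End.mul_apply, ← Module.End.mul_apply, ← map_mul, ← map_mul]
    congr 2
    group
  have hσ' : IrrR σ' := by
    refine ⟨hσ.1, fun U hU => hσ.2 U ?_⟩
    intro a x hx
    have := hU ((MulAut.conjNormal g : MulAut A) a) x hx
    have e : c ((MulAut.conjNormal g : MulAut A) a) = a := by
      ext
      simp [c, mul_assoc]
    simpa [σ', e] using this
  have := char_eq_of_bij _ ⟨inter_inj hσ' _ hg hi, inter_surj hτ _ hg hi⟩ hi
  rw [← this]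
  ext a
  simp only [conjSubChar, character, σ', MonoidHom.comp_apply]
  congr 2
  ext
  simp [c]

theorem faithful_of (A : Subgroup G) (hAn : A.Normal)
    (hsc : Subgroup.centralizer (A : Set G) = A) {σ : Representation k A V}
    {ρ : Representation k G W} (hσ : IrrR σ) (hσf : Function.Injective σ)
    (h : Inter σ (ρ.comp A.subtype)) : Function.Injective ρ := by
  obtain ⟨f, hf, hi⟩ := h
  have hinj := inter_inj hσ f hf hi
  have hA : ∀ a : A, ρ a = 1 → a = 1 := by
    intro a ha
    apply hσf
    ext v
    apply hinj
    rw [hi]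
    simp [ha]
  rw [injective_iff_map_eq_one]
  intro x hx
  have hxA : x ∈ A := by
    rw [← hsc, Subgroup.mem_centralizer_iff]
    intro a ha
    have := hA ⟨x * a * x⁻¹ * a⁻¹, A.mul_mem (hAn.conj_mem a ha x) (A.inv_mem ha)⟩ (by
      have h3 : ρ a * ρ a⁻¹ = 1 := by rw [← map_mul]; simp
      have h4 : ρ x * ρ x⁻¹ = 1 := by rw [← map_mul]; simp
      rw [hx, one_mul] at h4
      simp [map_mul, hx, h3, h4])
    have := congrArg Subtype.val this
    simp only [Subgroup.coe_one] at this
    have h2 : x * a = (x * a * x⁻¹ * a⁻¹) * (a * x) := by group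
    rw [h2, this, one_mul]
  exact congrArg Subtype.val (hA ⟨x, hxA⟩ hx)

theorem sub_faithful (A : Subgroup G) (hAn : A.Normal) (hAc : IsCyclic A)
    {σ : Representation k A V} {ρ : Representation k G W} (hρ : IrrR ρ)
    (hρf : Function.Injective ρ) 
    (h : Inter σ (ρ.comp A.subtype)) (hσ : IrrR σ) : Function.Injective σ := by
  obtain ⟨f, hf, hi⟩ := h
  have hinj := inter_inj hσ f hf hi
  by_contra hcon
  let N : Subgroup G := (MonoidHom.ker σ).map A.subtype
  have hN : N.Normal := normal_of_le_cyclic A hAn hAc N (by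
    rintro _ ⟨x, _, rfl⟩
    exact x.2)
  have hNb : N ≠ ⊥ := by
    intro hb
    apply hcon
    rw [← MonoidHom.ker_eq_bot_iff]
    exact (Subgroup.map_eq_bot_iff_of_injective _ A.subtype_injective).1 hb
  apply hf
  ext v
  refine fix_zero hρ hρf N hN hNb _ ?_
  rintro _ ⟨a, ha, rfl⟩
  have := hi a v
  rw [MonoidHom.mem_ker.1 ha] at this
  exact this.symm

def regR (k G : Type) [Field k] [Group G] : Representation k G (G → k) where
  toFun g := LinearMap.funLeft k k (fun x => x * g)
  map_one' := by ext; simp [LinearMap.funLeft]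
  map_mul' a b := by
    ext f x
    simp [LinearMap.funLeft, mul_assoc]

theorem inter_reg (A : Subgroup G) {σ : Representation k A V} (hσ : IrrR σ) :
    Inter σ ((regR k G).comp A.subtype) := by
  have := hσ.1
  obtain ⟨v, hv⟩ := exists_ne (0 : V)
  obtain ⟨l, hl⟩ : ∃ l : Module.Dual k V, l v ≠ 0 := by
    by_contra hcon
    push Not at hcon
    exact hv ((Module.forall_dual_apply_eq_zero_iff k v).1 hcon)
  refine ⟨LinearMap.pi fun x => if h : x ∈ A then l ∘ₗ σ ⟨x, h⟩ else 0, ?_, ?_⟩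
  · intro h0
    have := congrFun (LinearMap.congr_fun h0 v) 1
    simp [LinearMap.pi_apply, A.one_mem] at this
    apply hl
    have e : (⟨1, A.one_mem⟩ : A) = 1 := rfl
    rw [e, map_one] at this
    exact this
  · intro a v
    ext x
    simp only [LinearMap.pi_apply, regR, MonoidHom.comp_apply, MonoidHom.coe_mk, OneHom.coe_mk,
      LinearMap.funLeft_apply, Subgroup.subtype_apply]
    by_cases hx : x ∈ A
    · have hxa : x * a ∈ A := A.mul_mem hx a.2
      rw [dif_pos hx, dif_pos hxa]
      simp only [LinearMap.comp_apply]
      rw [← Module.End.mul_apply, ← map_mul]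
      rfl
    · have hxa : x * a ∉ A := fun h => hx ((A.mul_mem_cancel_right a.2).1 h)
      rw [dif_neg hx, dif_neg hxa]
      rfl

theorem finrank_dvd (A : Subgroup G) {ρ : Representation k G W} (hρ : IrrR ρ)
    (σ : Representation k A V) :
    finrank k (linHom ρ ρ).invariants ∣ finrank k (linHom σ (ρ.comp A.subtype)).invariants := by
  let D : Subalgebra k (Module.End k W) := Subalgebra.centralizer k (Set.range ρ)
  have hD : ∀ d : Module.End k W, d ∈ D ↔ ∀ g v, d (ρ g v) = ρ g (d v) := by
    intro d
    simp only [D, Subalgebra.mem_centralizer_iff, Set.forall_mem_range]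
    constructor
    · intro h g v
      exact (LinearMap.congr_fun (h g) v).symm
    · intro h g
      ext v
      exact (h g v).symm
  have hnt := hρ.1
  have : IsDomain D := by
    have : NoZeroDivisors D := by
      constructor
      intro a b hab
      by_contra hcon
      push Not at hcon
      have ha := inter_inj hρ a.1 (fun h => hcon.1 (Subtype.ext h)) ((hD _).1 a.2)
      apply hcon.2
      apply Subtype.ext
      ext v
      apply ha
      have := LinearMap.congr_fun (congrArg Subtype.val hab) v
      simpa using this
    exact NoZeroDivisors.to_isDomain D
  let _ : DivisionRing D := divisionRingOfFiniteDimensional k D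
  let M : Submodule D (V →ₗ[k] W) :=
    { carrier := {f | ∀ a v, f (σ a v) = (ρ.comp A.subtype) a (f v)}
      add_mem' := by
        intro f g hf hg a v
        simp only [LinearMap.add_apply, hf a v, hg a v, map_add]
      zero_mem' := by intro a v; simp
      smul_mem' := by
        intro d f hf a v
        have := (hD d.1).1 d.2 a (f v)
        change d.1 (f (σ a v)) = ρ a (d.1 (f v))
        rw [hf a v]
        exact this }
  have e1 : finrank k (linHom ρ ρ).invariants = finrank k D := by
    have : (linHom ρ ρ).invariants = Subalgebra.toSubmodule D := by
      ext d
      rw [mem_inv, Subalgebra.mem_toSubmodule, hD]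
    rw [this]
    rfl
  have e2 : finrank k (linHom σ (ρ.comp A.subtype)).invariants = finrank k M := by
    have : (linHom σ (ρ.comp A.subtype)).invariants = M.restrictScalars k := by
      ext d
      rw [mem_inv]
      rfl
    rw [this]
    rfl
  rw [e1, e2, ← Module.finrank_mul_finrank k D M]
  exact dvd_mul_right _ _

theorem sum_conj_sub (A : Subgroup G) (hAn : A.Normal) (g : G) (F : A → k) :
    ∑ a : A, F ⟨g⁻¹ * a * g, by simpa using hAn.conj_mem (a : G) a.2 g⁻¹⟩ = ∑ a : A, F a := by
  rw [← Equiv.sum_comp (MulAut.conjNormal g⁻¹ : MulAut A).toEquiv F]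
  refine Finset.sum_congr rfl fun a _ => ?_
  congr 1
  ext
  simp

theorem pr_conj (A : Subgroup G) (hAn : A.Normal) (g : G) (f : A → k)
    (ρ : Representation k G V) :
    pr (conjSubChar A hAn g f) (resChar A ρ.character) = pr f (resChar A ρ.character) := by
  unfold pr
  rw [← sum_conj_sub A hAn g (fun a => f a⁻¹ * resChar A ρ.character a)]
  refine Finset.sum_congr rfl fun a _ => ?_
  congr 1
  · simp only [conjSubChar]
    congr 1
    ext
    simp [mul_assoc]
  · simp only [resChar]
    have := char_conj ρ (a : G) g⁻¹
    rw [inv_inv] at this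
    exact this.symm

theorem sum_conj_conj (A : Subgroup G) (hAn : A.Normal) (g : G) (f : A → k) :
    ∑ x : G, conjSubChar A hAn x (conjSubChar A hAn g f) = ∑ x : G, conjSubChar A hAn x f := by
  rw [← Equiv.sum_comp (Equiv.mulRight g) (fun x => conjSubChar A hAn x f)]
  refine Finset.sum_congr rfl fun x _ => ?_
  ext a
  simp only [conjSubChar, Equiv.coe_mulRight]
  congr 1
  ext
  simp [mul_assoc]

theorem sum_conj_class (A : Subgroup G) (hAn : A.Normal) (ρ : Representation k G V) :
    ∑ x : G, conjSubChar A hAn x (resChar A ρ.character)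
      = (Nat.card G : k) • resChar A ρ.character := by
  have : ∀ x : G, conjSubChar A hAn x (resChar A ρ.character) = resChar A ρ.character := by
    intro x
    ext a
    have := char_conj ρ (a : G) x⁻¹
    rw [inv_inv] at this
    exact this
  simp [this]
  ext; simp

theorem occ_iff (V W : FDRep k H) (hV : IsIrr V) :
    CharOccurs V.character W.character ↔ pr V.character W.character ≠ 0 :=
  (occurs_iff V.ρ hV W.ρ).trans (pr_ne_iff V.ρ W.ρ).symm

theorem occ_res_iff (A : Subgroup G) (V : FDRep k A) (W : FDRep k G) (hV : IsIrr V) :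
    CharOccurs V.character (resChar A W.character) ↔
      Inter V.ρ (MonoidHom.comp W.ρ A.subtype) := 
  (occurs_iff V.ρ hV (MonoidHom.comp W.ρ A.subtype))

theorem pr_res_iff (A : Subgroup G) (V : FDRep k A) (W : FDRep k G) :
    pr V.character (resChar A W.character) ≠ 0 ↔
      Inter V.ρ (MonoidHom.comp W.ρ A.subtype) := 
  (pr_ne_iff V.ρ (MonoidHom.comp W.ρ A.subtype))

theorem main1 (A : Subgroup G) (hAn : A.Normal) (hAc : IsCyclic A)
    (hsc : Subgroup.centralizer (A : Set G) = A)
    (ψ : FDRep k G) (hψ : IsIrr ψ) (hψf : IsFaithfulRep ψ)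
    (ξ : FDRep k A) (hξ : IsIrr ξ) 
    (hov : CharOccurs ξ.character (resChar A ψ.character)) :
    ∃ n : ℕ, 0 < n ∧ indChar A ξ.character = n • ψ.character := by
  let R : Representation k A ψ := MonoidHom.comp ψ.ρ A.subtype
  have hR : resChar A ψ.character = R.character := rfl
  have hI := (occ_res_iff A ξ ψ hξ).1 hov
  obtain ⟨s, hs, hsum⟩ := decomp R
  let Q : A → k := ∑ x : G, conjSubChar A hAn x ξ.character
  -- every constituent is conjugate to ξ
  have hconj : ∀ X ∈ s, ∑ x : G, conjSubChar A hAn x X.character = Q := by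
    intro X hX
    have hpos : Inter X.ρ R := by
      rw [← pr_ne_iff, hsum, pr_list]
      have hnat : ∀ t : List (FDRep k A), ∃ m : ℕ,
          ((t.map FDRep.character).map (pr (Representation.character X.ρ))).sum
            = (Nat.card A : k) * m := by
        intro t
        induction t with
        | nil => exact ⟨0, by simp⟩
        | cons Y t ih =>
          obtain ⟨m, hm⟩ := ih
          refine ⟨finrank k (linHom X.ρ Y.ρ).invariants + m, ?_⟩
          rw [List.map_cons, List.map_cons, List.sum_cons, hm]
          rw [show Y.character = Representation.character Y.ρ from rfl, pair]
          push_cast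
          ring
      obtain ⟨l1, l2, rfl⟩ := List.append_of_mem hX
      obtain ⟨m1, h1⟩ := hnat l1
      obtain ⟨m2, h2⟩ := hnat l2
      rw [List.map_append, List.map_append, List.sum_append, List.map_cons, List.map_cons,
        List.sum_cons, h1, h2, show X.character = Representation.character X.ρ from rfl, pair]
      have hp : pr (Representation.character X.ρ) (Representation.character X.ρ) ≠ 0 := by
        rw [pr_ne_iff, ← occurs_iff X.ρ (hs X hX)]
        refine ⟨FDRep.of (1 : Representation k A PUnit), ?_⟩
        ext a
        simp [FDRep.character, finrank_zero_of_subsingleton]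
      rw [pair] at hp
      have hp' := (mul_ne_zero_iff.1 hp).2
      rw [← mul_add, ← mul_add]
      refine mul_ne_zero card_ne ?_
      norm_cast at hp' ⊢
      omega
    obtain ⟨g, hg⟩ := clifford A hAn (ρ := ψ.ρ) hψ (σ := ξ.ρ) (τ := X.ρ) hξ (hs X hX) hI hpos
    have hg' : X.character = conjSubChar A hAn g ξ.character := hg
    rw [hg', sum_conj_conj]
  have hQ : (Nat.card G : k) • resChar A ψ.character = (s.length : k) • Q := by
    have h1 := sum_conj_class A hAn ψ.ρ
    have h2 : ∀ t : List (FDRep k A), (∀ X ∈ t, ∑ x : G, conjSubChar A hAn x X.character = Q) →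
        ∑ x : G, conjSubChar A hAn x (t.map FDRep.character).sum = (t.length : k) • Q := by
      intro t ht
      induction t with
      | nil =>
        ext a
        simp [conjSubChar]
      | cons Y t ih =>
        have e : ∀ x, conjSubChar A hAn x ((Y :: t).map FDRep.character).sum =
            conjSubChar A hAn x Y.character + conjSubChar A hAn x (t.map FDRep.character).sum := by
          intro x
          ext a
          simp [conjSubChar]
        rw [Finset.sum_congr rfl fun x _ => e x, Finset.sum_add_distrib, ht Y (by simp),
          ih fun X hX => ht X (by simp [hX])]
        simp [add_smul, add_comm]
    have h3 := h2 s hconj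
    rw [← hsum] at h3
    exact h1.symm.trans h3
  set m : k := (s.length : k) with hm
  set d := finrank k (linHom ξ.ρ R).invariants with hd
  set δ := finrank k (linHom ψ.ρ ψ.ρ).invariants with hδ
  have hdpos : (d : k) ≠ 0 := by
    have := (pr_ne_iff ξ.ρ R).2 hI
    rw [pair] at this
    exact (mul_ne_zero_iff.1 this).2
  obtain ⟨n, hn⟩ : δ ∣ d := finrank_dvd A hψ ξ.ρ
  have hGne : (Nat.card G : k) ≠ 0 := card_ne
  have hAne : (Nat.card A : k) ≠ 0 := card_ne
  have hvan := char_vanish A hAn hAc hsc (ρ := ψ.ρ) hψ hψf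
  -- |G| * (|G| δ) = m * |G| * |A| d
  have hrel : (Nat.card G : k) * δ = m * ((Nat.card A : k) * d) := by
    have h1 : pr ψ.character ψ.character = (Nat.card G : k) * δ := pair ψ.ρ ψ.ρ
    have h2 : pr ξ.character (resChar A ψ.character) = (Nat.card A : k) * d := pair ξ.ρ R
    have h3 : pr Q (resChar A ψ.character) = (Nat.card G : k) * ((Nat.card A : k) * d) := by
      have : pr Q (resChar A ψ.character)
          = ∑ x : G, pr (conjSubChar A hAn x ξ.character) (resChar A ψ.character) := by
        unfold pr
        rw [Finset.sum_comm]
        simp [Q, Finset.sum_mul]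
      have hc : ∀ x : G, pr (conjSubChar A hAn x ξ.character) (resChar A ψ.character)
          = pr ξ.character (resChar A ψ.character) := fun x => pr_conj A hAn x ξ.character ψ.ρ
      rw [this, Finset.sum_congr rfl fun x _ => hc x, h2]
      simp
    have h4 : pr ψ.character ψ.character = pr (resChar A ψ.character) (resChar A ψ.character) :=
      pr_res A _ _ hvan
    have h5 : ∀ (c : k) (f f' : A → k), pr (c • f) f' = c * pr f f' := by
      intro c f f'
      simp [pr, Finset.mul_sum, mul_assoc]
    have h6 : (Nat.card G : k) * pr (resChar A ψ.character) (resChar A ψ.character)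
        = m * ((Nat.card G : k) * ((Nat.card A : k) * d)) := by
      rw [← h5, hQ, h5, h3]
    rw [← h4, h1] at h6
    apply mul_left_cancel₀ hGne
    rw [h6]
    ring
  have hδ0 : (δ : k) ≠ 0 := by
    intro h0
    apply hdpos
    rw [hn]
    push_cast
    rw [h0, zero_mul]
  have hm0 : m ≠ 0 := by
    intro h0
    rw [h0, zero_mul] at hrel
    exact mul_ne_zero hGne hδ0 hrel
  refine ⟨n, ?_, ?_⟩
  · rw [Nat.pos_iff_ne_zero]
    rintro rfl
    apply hdpos
    rw [hn]
    simp
  · have hGm : (Nat.card G : k) = m * ((Nat.card A : k) * n) := by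
      apply mul_right_cancel₀ hδ0
      rw [hrel, hn]
      push_cast
      ring
    ext g
    simp only [indChar, Pi.smul_apply, nsmul_eq_mul]
    rw [finsum_eq_sum_of_fintype]
    by_cases hg : g ∈ A
    · have h1 : (∑ x : G, if h : x⁻¹ * g * x ∈ A then ξ.character ⟨x⁻¹ * g * x, h⟩ else 0)
          = Q ⟨g, hg⟩ := by
        simp only [Q, Finset.sum_apply]
        refine Finset.sum_congr rfl fun x _ => ?_
        rw [dif_pos (by simpa using hAn.conj_mem g hg x⁻¹)]
        rfl
      rw [h1]
      have h2 := congrFun hQ ⟨g, hg⟩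
      simp only [Pi.smul_apply, smul_eq_mul, resChar] at h2
      rw [hGm] at h2
      have h3 : (Nat.card A : k) * n * ψ.character g = Q ⟨g, hg⟩ := by
        apply mul_left_cancel₀ hm0
        rw [← h2]
        ring
      rw [← h3, mul_assoc, inv_mul_cancel_left₀ hAne]
    · rw [show ψ.character g = 0 from hvan g hg, mul_zero]
      rw [Finset.sum_eq_zero, mul_zero]
      intro x _
      rw [dif_neg]
      intro h
      apply hg
      have := hAn.conj_mem _ h x
      simpa [mul_assoc] using this

end helpers

/-- Suppose the finite `p`-group `G` has a self-centralizing normal cyclic subgroup `A`,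
and let `ψ` be a faithful `𝕂G`-irrep overlapping with a faithful `𝕂A`-irrep `ξ`. Then
`ind_A^G ξ` is a direct sum of copies of `ψ`, and the overlap relation is a bijection
between the isomorphism classes of faithful `𝕂G`-irreps and the `G`-conjugacy classes of
faithful `𝕂A`-irreps. -/
theorem overlap_bijection (p : ℕ) (hp : p.Prime)
    (G : Type) [Group G] [Fintype G] (hG : IsPGroup p G)
    (k : Type) [Field k] [CharZero k]
    (A : Subgroup G) (hAn : A.Normal) (hAc : IsCyclic A)
    (hsc : Subgroup.centralizer (A : Set G) = A)
    (ψ : FDRep k G) (hψ : IsIrr ψ) (hψf : IsFaithfulRep ψ)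
    (ξ : FDRep k A) (hξ : IsIrr ξ) (hξf : IsFaithfulRep ξ)
    (hov : CharOccurs ξ.character (resChar A ψ.character)) :
    -- `ind_A^G ξ` is a direct sum of copies of `ψ`
    (∃ n : ℕ, 0 < n ∧ indChar A ξ.character = n • ψ.character) ∧
    -- every faithful irrep of `G` overlaps with some faithful irrep of `A`
    (∀ ψ' : FDRep k G, IsIrr ψ' → IsFaithfulRep ψ' →
      ∃ ξ' : FDRep k A, IsIrr ξ' ∧ IsFaithfulRep ξ' ∧
        CharOccurs ξ'.character (resChar A ψ'.character)) ∧
    -- any two faithful irreps of `A` overlapping the same irrep of `G` are `G`-conjugate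
    (∀ ψ' : FDRep k G, IsIrr ψ' → IsFaithfulRep ψ' →
      ∀ ξ₁ ξ₂ : FDRep k A, IsIrr ξ₁ → IsFaithfulRep ξ₁ → IsIrr ξ₂ → IsFaithfulRep ξ₂ →
        CharOccurs ξ₁.character (resChar A ψ'.character) →
        CharOccurs ξ₂.character (resChar A ψ'.character) →
        ∃ g : G, ξ₂.character = conjSubChar A hAn g ξ₁.character) ∧
    -- every faithful irrep of `A` overlaps with some faithful irrep of `G`
    (∀ ξ' : FDRep k A, IsIrr ξ' → IsFaithfulRep ξ' →
      ∃ ψ' : FDRep k G, IsIrr ψ' ∧ IsFaithfulRep ψ' ∧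
        CharOccurs ξ'.character (resChar A ψ'.character)) ∧
    -- two faithful irreps of `G` overlapping `G`-conjugate irreps of `A` are isomorphic
    (∀ ψ₁ ψ₂ : FDRep k G, IsIrr ψ₁ → IsFaithfulRep ψ₁ → IsIrr ψ₂ → IsFaithfulRep ψ₂ →
      ∀ ξ₁ ξ₂ : FDRep k A, IsIrr ξ₁ → IsFaithfulRep ξ₁ → IsIrr ξ₂ → IsFaithfulRep ξ₂ →
        CharOccurs ξ₁.character (resChar A ψ₁.character) →
        CharOccurs ξ₂.character (resChar A ψ₂.character) →
        (∃ g : G, ξ₂.character = conjSubChar A hAn g ξ₁.character) →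
        ψ₁.character = ψ₂.character) := by
  refine ⟨main1 A hAn hAc hsc ψ hψ hψf ξ hξ hov, ?_, ?_, ?_, ?_⟩
  · intro ψ' h' hf'
    let R : Representation k A ψ' := MonoidHom.comp ψ'.ρ A.subtype
    obtain ⟨s, hs, hsum⟩ := decomp R
    have hex : ∃ X ∈ s, pr X.character R.character ≠ 0 := by
      by_contra hcon
      push Not at hcon
      have h0 : pr R.character R.character = 0 := by
        nth_rewrite 2 [hsum]
        rw [pr_list, List.sum_eq_zero]
        intro y hy
        simp only [List.mem_map, exists_exists_and_eq_and] at hy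
        obtain ⟨X, hX, rfl⟩ := hy
        rw [pr_comm]
        exact hcon X hX
      refine (pr_ne_iff R R).2 ⟨LinearMap.id, ?_, fun _ _ => rfl⟩ h0
      intro h
      have := h'.1
      obtain ⟨x, hx⟩ := exists_ne (0 : ψ')
      exact hx (LinearMap.congr_fun h x)
    obtain ⟨X, hX, hne⟩ := hex
    have hI : Inter X.ρ R := (pr_res_iff A X ψ').1 hne
    exact ⟨X, hs X hX, sub_faithful A hAn hAc (ρ := ψ'.ρ) h' hf' hI (hs X hX),
      (occ_res_iff A X ψ' (hs X hX)).2 hI⟩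
  · intro ψ' h' hf' ξ₁ ξ₂ h1 _ h2 _ o1 o2
    exact clifford A hAn (ρ := ψ'.ρ) h' (σ := ξ₁.ρ) (τ := ξ₂.ρ) h1 h2
      ((occ_res_iff A ξ₁ ψ' h1).1 o1) ((occ_res_iff A ξ₂ ψ' h2).1 o2)
  · intro ξ' h' hf'
    have hreg := (pr_ne_iff ξ'.ρ ((regR k G).comp A.subtype)).2 (inter_reg A (σ := ξ'.ρ) h')
    obtain ⟨s, hs, hsum⟩ := decomp (regR k G)
    have hex : ∃ X ∈ s, pr ξ'.character (resChar A X.character) ≠ 0 := by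
      by_contra hcon
      push Not at hcon
      apply hreg
      have e : Representation.character ((regR k G).comp A.subtype)
          = ((s.map FDRep.character).map (resChar A)).sum := by
        have e1 : Representation.character ((regR k G).comp A.subtype)
          = resChar A (regR k G).character := rfl
        rw [e1, hsum]
        generalize s.map FDRep.character = t
        induction t with
        | nil => rfl
        | cons a t ih =>
          rw [List.sum_cons, List.map_cons, List.sum_cons, ← ih]
          rfl
      rw [e, pr_list, List.sum_eq_zero]
      intro y hy
      simp only [List.mem_map, exists_exists_and_eq_and] at hy
      obtain ⟨X, hX, rfl⟩ := hy
      exact hcon X hX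
    obtain ⟨X, hX, hne⟩ := hex
    have hI := (pr_res_iff A ξ' X).1 hne
    exact ⟨X, hs X hX, faithful_of A hAn hsc (σ := ξ'.ρ) (ρ := X.ρ) h' hf' hI,
      (occ_res_iff A ξ' X h').2 hI⟩
  · intro ψ₁ ψ₂ i1 f1 i2 f2 ξ₁ ξ₂ j1 _ j2 _ o1 o2 ⟨g, hg⟩
    have p2 := (pr_res_iff A ξ₂ ψ₂).2 ((occ_res_iff A ξ₂ ψ₂ j2).1 o2)
    rw [hg] at p2
    have e2 : pr (conjSubChar A hAn g ξ₁.character) (resChar A ψ₂.character)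
      = pr ξ₁.character (resChar A ψ₂.character) := pr_conj A hAn g ξ₁.character ψ₂.ρ
    rw [e2] at p2
    obtain ⟨X, hX⟩ := o1
    let R : Representation k A ψ₂ := MonoidHom.comp ψ₂.ρ A.subtype
    have hne : pr ψ₁.character ψ₂.character ≠ 0 := by
      rw [pr_res A ψ₁.character ψ₂.character (char_vanish A hAn hAc hsc (ρ := ψ₂.ρ) i2 f2), hX, pr_add_left]
      have q1 : pr ξ₁.character (resChar A ψ₂.character) = _ := pair ξ₁.ρ R
      have q2 : pr X.character (resChar A ψ₂.character) = _ := pair X.ρ R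
      rw [q1] at p2
      rw [q1, q2, ← mul_add]
      have p3 := (mul_ne_zero_iff.1 p2).2
      refine mul_ne_zero card_ne ?_
      norm_cast at p3 ⊢
      omega
    obtain ⟨f, hf, hi⟩ := (pr_ne_iff ψ₁.ρ ψ₂.ρ).1 hne
    exact char_eq_of_bij (ρ := ψ₁.ρ) (σ := ψ₂.ρ) f
      ⟨inter_inj (ρ := ψ₁.ρ) (σ := ψ₂.ρ) i1 f hf hi,
        inter_surj (ρ := ψ₁.ρ) (σ := ψ₂.ρ) i2 f hf hi⟩ hi

end Genotype
end
end

section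
/- If G is a Roquette p-group, then the automorphism group Aut(G) acts transitively on the set of isomorphism classes of faithful 𝕂G-irreps. -/
open scoped Classical

noncomputable section

namespace Genotype

theorem clo_aux {G : Type} [Group G] (S : Set G) (hc : ∀ x ∈ S, ∀ y ∈ S, x * y = y * x)
    (hn : ∀ x ∈ S, ∀ g : G, g * x * g⁻¹ ∈ Subgroup.closure S) :
    (Subgroup.closure S).Normal ∧ ∀ x ∈ Subgroup.closure S, ∀ y ∈ Subgroup.closure S, x * y = y * x := by
  constructor
  · refine ⟨fun n hn' g => ?_⟩
    have : Subgroup.closure S ≤ (Subgroup.closure S).comap (MulAut.conj g).toMonoidHom := by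
      rw [Subgroup.closure_le]
      intro x hx
      simpa using hn x hx g
    simpa using this hn'
  · have h1 : Subgroup.closure S ≤ Subgroup.centralizer S := by
      rw [Subgroup.closure_le]
      intro x hx
      rw [SetLike.mem_coe, Subgroup.mem_centralizer_iff]
      intro y hy
      exact hc y hy x hx
    have h2 : Subgroup.closure S ≤ Subgroup.centralizer (Subgroup.closure S) := by
      rw [Subgroup.closure_le]
      intro x hx
      rw [SetLike.mem_coe, Subgroup.mem_centralizer_iff]
      intro y hy
      exact ((Subgroup.mem_centralizer_iff.1 (h1 hy)) x hx).symm
    intro x hx y hy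
    exact (Subgroup.mem_centralizer_iff.1 (h2 hy)) x hx

theorem normal_center {p : ℕ} [Fact p.Prime] {Q : Type} [Group Q] [Finite Q] (hQ : IsPGroup p Q)
    (N : Subgroup Q) [N.Normal] (x : Q) (hx : x ∈ N) (hx1 : x ≠ 1) :
    ∃ y ∈ N, y ≠ 1 ∧ ∀ g, g * y = y * g := by
  have hP : IsPGroup p (ConjAct Q) := hQ.of_equiv (ConjAct.toConjAct)
  have : Nontrivial N := ⟨⟨x, hx⟩, 1, fun h => hx1 (by simpa using congrArg Subtype.val h)⟩
  have hd : p ∣ Nat.card N := by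
    rcases (hQ.to_subgroup N).card_eq_or_dvd with h | h
    · have := Finite.one_lt_card (α := N); omega
    · exact h
  obtain ⟨b, hb, hb1⟩ := hP.exists_fixed_point_of_prime_dvd_card_of_fixed_point N hd (a := 1) (by
    intro g; simp)
  refine ⟨b, b.2, fun h => hb1 (Subtype.ext h.symm), fun g => ?_⟩
  have := congrArg Subtype.val (hb (ConjAct.toConjAct g))
  rw [ConjAct.Subgroup.val_conj_smul, ConjAct.smul_def] at this
  simpa [mul_inv_eq_iff_eq_mul] using this

theorem exists_selfcent {p : ℕ} [Fact p.Prime] {G : Type} [Group G] [Finite G] (hG : IsPGroup p G) :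
    ∃ A : Subgroup G, A.Normal ∧ (∀ x ∈ A, ∀ y ∈ A, x * y = y * x) ∧
      ∀ g, (∀ x ∈ A, x * g = g * x) → g ∈ A := by
  obtain ⟨A, hA⟩ := Set.Finite.exists_maximal (s := {A : Subgroup G | A.Normal ∧ (∀ x ∈ A, ∀ y ∈ A, x * y = y * x)})
    (Set.toFinite _) ⟨⊥, inferInstance, by simp⟩
  obtain ⟨⟨hn, hc⟩, hmax⟩ := hA
  refine ⟨A, hn, hc, fun g hg => ?_⟩
  by_contra hgA
  let C := Subgroup.centralizer (A : Set G)
  have hgC : g ∈ C := Subgroup.mem_centralizer_iff.2 hg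
  have : (C.map (QuotientGroup.mk' A)).Normal := Subgroup.Normal.map inferInstance _ (QuotientGroup.mk'_surjective A)
  obtain ⟨y, hyN, hy1, hyc⟩ := normal_center (hG.to_quotient A) (C.map (QuotientGroup.mk' A))
    (QuotientGroup.mk' A g) ⟨g, hgC, rfl⟩ (by simpa using hgA)
  obtain ⟨x, hxC, rfl⟩ := hyN
  have hxA : x ∉ A := by simpa using hy1
  have hcom : ∀ h : G, h * x * h⁻¹ * x⁻¹ ∈ A := by
    intro h
    have := hyc (QuotientGroup.mk' A h)
    rw [← QuotientGroup.eq_one_iff]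
    simp at this ⊢
    rw [this]; simp
  have hxc := Subgroup.mem_centralizer_iff.1 hxC
  have := clo_aux ((A : Set G) ∪ {x}) (by
    rintro u (hu | rfl) v (hv | rfl)
    · exact hc u hu v hv
    · exact hxc u hu
    · exact (hxc v hv).symm
    · rfl) (by
    rintro u (hu | rfl) h
    · exact Subgroup.subset_closure (Or.inl (hn.conj_mem u hu h))
    · have := Subgroup.mul_mem _ (Subgroup.subset_closure (Or.inl (hcom h)) : _ ∈ Subgroup.closure ((A : Set G) ∪ {u}))
        (Subgroup.subset_closure (Or.inr rfl) : u ∈ Subgroup.closure ((A : Set G) ∪ {u}))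
      simpa using this)
  have h3 := hmax this (fun u hu => Subgroup.subset_closure (Or.inl hu))
  exact hxA (h3 (Subgroup.subset_closure (Or.inr rfl)))

theorem geom_aux (p t : ℕ) (hp : p.Prime) (h1 : t ≡ 1 [MOD p]) (h2 : p = 2 → t ≡ 1 [MOD 4]) :
    ∃ u : ℕ, p.Coprime u ∧ ∑ i ∈ Finset.range p, t ^ i = p * u := by
  rcases hp.eq_two_or_odd' with rfl | ho
  · have := h2 rfl
    obtain ⟨m, rfl⟩ : ∃ m, t = 1 + 4 * m := ⟨t / 4, by unfold Nat.ModEq at this; omega⟩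
    refine ⟨1 + 2 * m, by simp, ?_⟩
    simp [Finset.sum_range_succ]; ring
  · have hpZ : Prime (p : ℤ) := Nat.prime_iff_prime_int.1 hp
    have hd : (p : ℤ) ∣ (t : ℤ) - 1 := (Nat.modEq_iff_dvd.1 h1.symm)
    have hnd : ¬ (p : ℤ) ∣ (t : ℤ) := by
      intro h
      have : (p : ℤ) ∣ 1 := by simpa using dvd_sub h hd
      exact hpZ.not_isUnit (isUnit_of_dvd_one this)
    have := emultiplicity_geom_sum₂_eq_one hpZ ho hd hnd
    simp only [one_pow, mul_one] at this
    have hS : ((∑ i ∈ Finset.range p, t ^ i : ℕ) : ℤ) = ∑ i ∈ Finset.range p, (t : ℤ) ^ i := by push_cast; rfl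
    rw [← hS, Int.natCast_emultiplicity] at this
    rw [show (1 : ℕ∞) = ((1 : ℕ) : ℕ∞) from rfl, emultiplicity_eq_coe] at this
    obtain ⟨⟨u, hu⟩, h4⟩ := this
    rw [pow_one] at hu
    refine ⟨u, (Nat.Prime.coprime_iff_not_dvd hp).2 ?_, hu⟩
    rintro ⟨w, rfl⟩
    exact h4 ⟨w, by rw [hu]; ring⟩
end Genotype
namespace Genotype

theorem conj_exp {G : Type} [Group G] [Finite G] {a : G} (hn : (Subgroup.zpowers a).Normal) (g : G) :
    ∃ s : ℕ, g * a * g⁻¹ = a ^ s := by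
  have := hn.conj_mem a (Subgroup.mem_zpowers a) g
  rw [← mem_powers_iff_mem_zpowers] at this
  obtain ⟨s, hs⟩ := this
  exact ⟨s, hs.symm⟩

theorem conj_pow_aux {G : Type} [Group G] [Finite G] {a g : G} {t : ℕ} (h : g * a * g⁻¹ = a ^ t)
    {c : G} (hc : c ∈ Subgroup.zpowers a) : g * c * g⁻¹ = c ^ t := by
  rw [← mem_powers_iff_mem_zpowers] at hc
  obtain ⟨s, rfl⟩ := hc
  simp only
  rw [← conj_pow, h, ← pow_mul, ← pow_mul, mul_comm]

theorem zcomm {G : Type} [Group G] {a x y : G} (hx : x ∈ Subgroup.zpowers a)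
    (hy : y ∈ Subgroup.zpowers a) : x * y = y * x := by
  obtain ⟨i, rfl⟩ := hx
  obtain ⟨j, rfl⟩ := hy
  simp only
  rw [← zpow_add, ← zpow_add, add_comm]

theorem mul_pow_aux {G : Type} [Group G] [Finite G] {a g : G} {t : ℕ} (h : g * a * g⁻¹ = a ^ t)
    {c : G} (hc : c ∈ Subgroup.zpowers a) (i : ℕ) :
    (c * g) ^ i = c ^ (∑ j ∈ Finset.range i, t ^ j) * g ^ i := by
  induction i with
  | zero => simp
  | succ i ih =>
    have h1 := conj_pow_aux h (Subgroup.pow_mem _ hc (∑ j ∈ Finset.range i, t ^ j))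
    rw [mul_inv_eq_iff_eq_mul] at h1
    rw [pow_succ', ih, geom_sum_succ, pow_succ', pow_add, pow_one, mul_comm t, pow_mul]
    have : c * g * (c ^ (∑ j ∈ Finset.range i, t ^ j) * g ^ i) = c * (g * c ^ (∑ j ∈ Finset.range i, t ^ j)) * g ^ i := by group
    rw [this, h1]
    simp only [mul_assoc, ← pow_succ', ← pow_succ]

theorem comm_mem {G : Type} [Group G] [Finite G] {a : G} (hn : (Subgroup.zpowers a).Normal)
    (hC : ∀ g : G, g * a = a * g → g ∈ Subgroup.zpowers a) (g y : G) :
    g * y * g⁻¹ * y⁻¹ ∈ Subgroup.zpowers a := by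
  obtain ⟨s, hs⟩ := conj_exp hn g⁻¹
  obtain ⟨t, ht⟩ := conj_exp hn y⁻¹
  have h1 : g⁻¹ * (y⁻¹ * a * y⁻¹⁻¹) * g⁻¹⁻¹ = y⁻¹ * (g⁻¹ * a * g⁻¹⁻¹) * y⁻¹⁻¹ := by
    rw [ht, hs, conj_pow_aux hs (Subgroup.pow_mem _ (Subgroup.mem_zpowers a) _),
      conj_pow_aux ht (Subgroup.pow_mem _ (Subgroup.mem_zpowers a) _), ← pow_mul, ← pow_mul, mul_comm]
  apply hC
  simp only [inv_inv] at h1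
  have h2 : g⁻¹ * y⁻¹ * a = y⁻¹ * g⁻¹ * a * g * y * g⁻¹ * y⁻¹ := by
    calc g⁻¹ * y⁻¹ * a = g⁻¹ * (y⁻¹ * a * y) * g * g⁻¹ * y⁻¹ := by group
      _ = _ := by rw [h1]; group
  calc g * y * g⁻¹ * y⁻¹ * a = g * y * (g⁻¹ * y⁻¹ * a) := by group
    _ = _ := by rw [h2]; group

theorem no_good {p : ℕ} [hp : Fact p.Prime] {G : Type} [Group G] [Finite G] (hG : IsPGroup p G)
    (hR : IsRoquette G) {a : G} (hn : (Subgroup.zpowers a).Normal)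
    (hC : ∀ g : G, g * a = a * g → g ∈ Subgroup.zpowers a) {y : G} {t : ℕ}
    (hy : y * a * y⁻¹ = a ^ t) (h1 : t ≡ 1 [MOD p]) (h2 : p = 2 → t ≡ 1 [MOD 4])
    (hyA : y ∉ Subgroup.zpowers a) (hyp : y ^ p ∈ Subgroup.zpowers a) : False := by
  obtain ⟨u, hu, hS⟩ := geom_aux p t hp.out h1 h2
  have hypow : ∃ d ∈ Subgroup.zpowers a, y ^ p = d ^ p := by
    have h3 := hyp
    rw [← mem_powers_iff_mem_zpowers] at h3
    obtain ⟨r, hr⟩ := h3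
    simp only at hr
    by_cases hpr : p ∣ r
    · obtain ⟨r', rfl⟩ := hpr
      exact ⟨a ^ r', Subgroup.pow_mem _ (Subgroup.mem_zpowers a) _, by rw [← hr, mul_comm, pow_mul]⟩
    · exfalso
      have hc : p.Coprime r := (Nat.Prime.coprime_iff_not_dvd hp.out).2 hpr
      have h4 := conj_pow_aux hy hyp
      have h5 : y * y ^ p * y⁻¹ = y ^ p := by rw [← pow_succ', pow_succ]; group
      rw [h5, ← hr, ← pow_mul, mul_comm, pow_mul] at h4
      have h6 : a = a ^ t := (hG.powEquiv hc).injective (by simpa using h4)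
      rw [← h6, mul_inv_eq_iff_eq_mul] at hy
      exact hyA (hC y hy)
  obtain ⟨d, hd, hyd⟩ := hypow
  obtain ⟨c, hc, hcd⟩ : ∃ c ∈ Subgroup.zpowers a, c ^ u = d⁻¹ := by
    refine ⟨(hG.powEquiv hu).symm d⁻¹, ?_, ?_⟩
    · rw [hG.powEquiv_symm_apply]
      exact Subgroup.zpow_mem _ (Subgroup.inv_mem _ hd) _
    · rw [← hG.powEquiv_apply hu, Equiv.apply_symm_apply]
  set y0 := c * y with hy0
  have hy0A : y0 ∉ Subgroup.zpowers a := fun h => hyA ((Subgroup.mul_mem_cancel_left _ hc).1 h)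
  have hy0p : y0 ^ p = 1 := by
    rw [hy0, mul_pow_aux hy hc, hS, mul_comm, pow_mul, hcd, hyd]; simp
  have hy0a : y0 * a * y0⁻¹ = a ^ t := by
    have h3 := zcomm hc (Subgroup.pow_mem _ (Subgroup.mem_zpowers a) t)
    calc y0 * a * y0⁻¹ = c * (y * a * y⁻¹) * c⁻¹ := by rw [hy0]; group
      _ = _ := by rw [hy, h3]; group
  have ht : ∀ w : G, w ^ p = 1 → w ^ t = w := by
    intro w hw
    have : w ^ t = w ^ 1 := pow_eq_pow_iff_modEq.2 (h1.of_dvd (orderOf_dvd_of_pow_eq_one hw))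
    simpa using this
  let S : Set G := {c | c ∈ Subgroup.zpowers a ∧ c ^ p = 1} ∪ {y0}
  have hcm : ∀ c ∈ Subgroup.zpowers a, c ^ p = 1 → c * y0 = y0 * c := by
    intro c hc hcp
    have := conj_pow_aux hy0a hc
    rw [ht c hcp, mul_inv_eq_iff_eq_mul] at this
    exact this.symm
  obtain ⟨hEn, hEc⟩ := clo_aux S (by
    rintro u (⟨hu, hu'⟩ | rfl) v (⟨hv, hv'⟩ | rfl)
    · exact zcomm hu hv
    · exact hcm u hu hu'
    · exact (hcm v hv hv').symm
    · rfl) (by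
    rintro v (⟨hv, hv'⟩ | rfl) h
    · exact Subgroup.subset_closure (Or.inl ⟨hn.conj_mem v hv h, by rw [conj_pow, hv']; simp⟩)
    · have hw := comm_mem hn hC h y0
      set w := h * y0 * h⁻¹ * y0⁻¹ with hwdef
      have e : h * y0 * h⁻¹ = w * y0 := by rw [hwdef]; group
      have h3 : (w * y0) ^ p = 1 := by rw [← e, conj_pow, hy0p]; simp
      rw [mul_pow_aux hy0a hw, hy0p, mul_one, hS, pow_mul] at h3
      have h4 : w ^ p = 1 := (hG.powEquiv hu).injective (by simpa using h3)
      rw [e]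
      exact Subgroup.mul_mem _ (Subgroup.subset_closure (Or.inl ⟨hw, h4⟩))
        (Subgroup.subset_closure (Or.inr rfl)))
  have hEp : ∀ e ∈ Subgroup.closure S, e ^ p = 1 := by
    intro e he
    induction he using Subgroup.closure_induction with
    | mem x hx =>
      rcases hx with ⟨_, h⟩ | rfl
      · exact h
      · exact hy0p
    | one => simp
    | mul x y hx hy h h' => rw [Commute.mul_pow (hEc x hx y hy), h, h', one_mul]
    | inv x hx h => rw [inv_pow, h, inv_one]
  obtain ⟨⟨e, he⟩, hgen⟩ := (hR _ hEn hEc).exists_generator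
  have ha1 : a ≠ 1 := by rintro rfl; exact hyA (hC y (by simp))
  obtain ⟨z, hzA, hzp, hz1⟩ : ∃ z ∈ Subgroup.zpowers a, z ^ p = 1 ∧ z ≠ 1 := by
    obtain ⟨m, hm⟩ := hG.dvd_orderOf ha1
    refine ⟨a ^ m, Subgroup.pow_mem _ (Subgroup.mem_zpowers a) _, ?_, ?_⟩
    · rw [← pow_mul, mul_comm, ← hm, pow_orderOf_eq_one]
    · intro h
      have h0 := orderOf_dvd_of_pow_eq_one h
      have := orderOf_pos a
      have hm0 : 0 < m := by rcases Nat.eq_zero_or_pos m with rfl | h'; · rw [mul_zero] at hm; omega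
                             · exact h'
      have := Nat.le_of_dvd hm0 h0
      have := hp.out.two_le
      nlinarith
  have hzE : z ∈ Subgroup.closure S := Subgroup.subset_closure (Or.inl ⟨hzA, hzp⟩)
  obtain ⟨i, hi⟩ := hgen ⟨z, hzE⟩
  obtain ⟨j, hj⟩ := hgen ⟨y0, Subgroup.subset_closure (Or.inr rfl)⟩
  have hi' : e ^ i = z := by simpa using congrArg Subtype.val hi
  have hj' : e ^ j = y0 := by simpa using congrArg Subtype.val hj
  have hep := hEp e he
  have hpi : ¬ (p : ℤ) ∣ i := by
    rintro ⟨m, rfl⟩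
    apply hz1
    rw [← hi', zpow_mul, zpow_natCast, hep, one_zpow]
  obtain ⟨α, β, hαβ⟩ := ((Nat.prime_iff_prime_int.1 hp.out).coprime_iff_not_dvd.2 hpi)
  have heA : e ∈ Subgroup.zpowers a := by
    have : e = z ^ β := by
      calc e = e ^ (α * p + β * i) := by rw [hαβ, zpow_one]
        _ = _ := by rw [zpow_add, mul_comm, mul_comm β, zpow_mul, zpow_mul]; simp [hep, hi']
    rw [this]; exact Subgroup.zpow_mem _ hzA _
  exact hy0A (hj' ▸ Subgroup.zpow_mem _ heA _)

theorem good_mem {p : ℕ} [hp : Fact p.Prime] {G : Type} [Group G] [Finite G] (hG : IsPGroup p G)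
    (hR : IsRoquette G) {a : G} (hn : (Subgroup.zpowers a).Normal)
    (hC : ∀ g : G, g * a = a * g → g ∈ Subgroup.zpowers a) {x : G} {t : ℕ}
    (hx : x * a * x⁻¹ = a ^ t) (h1 : t ≡ 1 [MOD p]) (h2 : p = 2 → t ≡ 1 [MOD 4]) :
    x ∈ Subgroup.zpowers a := by
  by_contra hxA
  have hxi : ∀ i : ℕ, x ^ i * a * (x ^ i)⁻¹ = a ^ (t ^ i) := by
    intro i
    induction i with
    | zero => simp
    | succ i ih =>
      calc x ^ (i+1) * a * (x ^ (i+1))⁻¹ = x * (x ^ i * a * (x ^ i)⁻¹) * x⁻¹ := by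
            rw [pow_succ']; group
        _ = _ := by rw [ih, conj_pow_aux hx (Subgroup.pow_mem _ (Subgroup.mem_zpowers a) _), ← pow_mul, pow_succ]
  have hex : ∃ j : ℕ, x ^ p ^ j ∈ Subgroup.zpowers a := by
    obtain ⟨j, hj⟩ := isPGroup_iff_pow_pow_eq_one.1 hG x
    exact ⟨j, by rw [hj]; exact Subgroup.one_mem _⟩
  have hspec := Nat.find_spec hex
  rcases hj : Nat.find hex with _ | j
  · rw [hj] at hspec; simp at hspec; exact hxA (by simpa using hspec)
  · rw [hj] at hspec
    have hmin := Nat.find_min hex (m := j) (by omega)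
    refine no_good hG hR hn hC (hxi (p ^ j)) ?_ ?_ hmin ?_
    · simpa using h1.pow (p ^ j)
    · intro h; simpa using (h2 h).pow (p ^ j)
    · rwa [← pow_mul, ← pow_succ]

theorem struct {p : ℕ} [hp : Fact p.Prime] {G : Type} [Group G] [Finite G] (hG : IsPGroup p G)
    (hR : IsRoquette G) : ∃ a : G, (Subgroup.zpowers a).Normal ∧
      (∀ g : G, g * a = a * g → g ∈ Subgroup.zpowers a) ∧
      ((∀ g, g ∈ Subgroup.zpowers a) ∨ (p = 2 ∧ ∀ x y, x ∉ Subgroup.zpowers a →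
        y ∉ Subgroup.zpowers a → x * y ∈ Subgroup.zpowers a)) := by
  obtain ⟨A, hn, hc, hC⟩ := exists_selfcent hG
  have hcyc := hR A hn hc
  obtain ⟨⟨a, ha⟩, hgen⟩ := hcyc.exists_generator
  have hAa : A = Subgroup.zpowers a := by
    apply le_antisymm
    · intro x hx
      obtain ⟨i, hi⟩ := hgen ⟨x, hx⟩
      exact ⟨i, by simpa using congrArg Subtype.val hi⟩
    · simpa using ha
  subst hAa
  have hC' : ∀ g : G, g * a = a * g → g ∈ Subgroup.zpowers a := by
    intro g hg
    apply hC
    rintro x ⟨i, rfl⟩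
    exact (Commute.zpow_left (show Commute a g from hg.symm) i)
  refine ⟨a, hn, hC', ?_⟩
  have key : ∀ x : G, ∃ t : ℕ, x * a * x⁻¹ = a ^ t ∧ t ≡ 1 [MOD p] := by
    intro x
    by_cases ha1 : a = 1
    · exact ⟨1, by simp [ha1], rfl⟩
    obtain ⟨t, ht⟩ := conj_exp hn x
    refine ⟨t, ht, ?_⟩
    have hxi : ∀ i : ℕ, x ^ i * a * (x ^ i)⁻¹ = a ^ (t ^ i) := by
      intro i
      induction i with
      | zero => simp
      | succ i ih =>
        calc x ^ (i+1) * a * (x ^ (i+1))⁻¹ = x * (x ^ i * a * (x ^ i)⁻¹) * x⁻¹ := by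
              rw [pow_succ']; group
          _ = _ := by rw [ih, conj_pow_aux ht (Subgroup.pow_mem _ (Subgroup.mem_zpowers a) _), ← pow_mul, pow_succ]
    obtain ⟨j, hj⟩ := isPGroup_iff_pow_pow_eq_one.1 hG x
    have h3 := hxi (p ^ j)
    rw [hj] at h3
    have h4 : a ^ 1 = a ^ (t ^ p ^ j) := by simpa using h3
    have h5 := (pow_eq_pow_iff_modEq.1 h4).of_dvd (hG.dvd_orderOf ha1)
    rw [← ZMod.natCast_eq_natCast_iff] at h5 ⊢
    simpa [ZMod.pow_card_pow] using h5.symm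
  rcases hp.out.eq_two_or_odd' with rfl | ho
  · right
    refine ⟨rfl, fun x y hx hy => ?_⟩
    obtain ⟨t, ht, ht1⟩ := key x
    obtain ⟨s, hs, hs1⟩ := key y
    have e1 : t % 4 = 3 := by
      by_contra h
      exact hx (good_mem hG hR hn hC' ht ht1 (fun _ => by unfold Nat.ModEq at *; omega))
    have e2 : s % 4 = 3 := by
      by_contra h
      exact hy (good_mem hG hR hn hC' hs hs1 (fun _ => by unfold Nat.ModEq at *; omega))
    have e3 : t * s ≡ 1 [MOD 4] := by
      unfold Nat.ModEq; rw [Nat.mul_mod, e1, e2]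
    refine good_mem hG hR hn hC' (t := t * s) ?_ (by simpa using ht1.mul hs1) (fun _ => e3)
    calc x * y * a * (x * y)⁻¹ = x * (y * a * y⁻¹) * x⁻¹ := by group
      _ = _ := by rw [hs, conj_pow_aux ht (Subgroup.pow_mem _ (Subgroup.mem_zpowers a) _), ← pow_mul, mul_comm]
  · left
    intro g
    obtain ⟨t, ht, ht1⟩ := key g
    refine good_mem hG hR hn hC' ht ht1 (fun h => ?_)
    subst h
    exact absurd ho (by decide)

/-- automorphism -/
theorem exists_aut {p : ℕ} [hp : Fact p.Prime] {G : Type} [Group G] [Finite G] (hG : IsPGroup p G)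
    {a : G} (hn : (Subgroup.zpowers a).Normal)
    (h : (∀ g, g ∈ Subgroup.zpowers a) ∨ (p = 2 ∧ ∀ x y, x ∉ Subgroup.zpowers a →
        y ∉ Subgroup.zpowers a → x * y ∈ Subgroup.zpowers a)) (s : ℕ) (hs : p.Coprime s) :
    ∃ θ : G ≃* G, θ a = a ^ s := by
  by_cases hall : ∀ g, g ∈ Subgroup.zpowers a
  · let f : G →* G :=
      { toFun := fun g => g ^ s
        map_one' := by simp
        map_mul' := fun x y => Commute.mul_pow (zcomm (hall x) (hall y)) s }
    exact ⟨MulEquiv.ofBijective f (hG.powEquiv hs).bijective, rfl⟩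
  obtain ⟨rfl, h2⟩ := h.resolve_left hall
  push Not at hall
  obtain ⟨g, hg⟩ := hall
  set A := Subgroup.zpowers a with hA
  have hso : Odd s := by rwa [← Nat.coprime_two_left]
  have hgg : g * g ∈ A := h2 g g hg hg
  have hgs : g ^ s ∉ A := by
    obtain ⟨m, rfl⟩ := hso
    intro h
    rw [pow_succ, pow_mul, pow_two] at h
    exact hg ((Subgroup.mul_mem_cancel_left _ (Subgroup.pow_mem _ hgg m)).1 h)
  have hconj : ∀ v ∈ A, g ^ s * v = (g * v * g⁻¹) * g ^ s := by
    intro v hv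
    obtain ⟨m, rfl⟩ := hso
    have h3 : (g * g) ^ m * v = v * (g * g) ^ m := zcomm (Subgroup.pow_mem _ hgg m) hv
    rw [pow_succ', pow_mul, pow_two]
    calc g * (g * g) ^ m * v = g * ((g * g) ^ m * v) := by group
      _ = _ := by rw [h3]; group
  have hcoset : ∀ x, x ∉ A → x * g⁻¹ ∈ A := by
    intro x hx
    have := h2 x g hx hg
    have e : x * g⁻¹ = x * g * (g * g)⁻¹ := by group
    rw [e]; exact Subgroup.mul_mem _ this (Subgroup.inv_mem _ hgg)
  let F : G → G := fun x => if x ∈ A then x ^ s else (x * g⁻¹) ^ s * g ^ s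
  have F1 : ∀ x ∈ A, F x = x ^ s := fun x hx => if_pos hx
  have F2 : ∀ u ∈ A, F (u * g) = u ^ s * g ^ s := by
    intro u hu
    have : u * g ∉ A := fun h => hg ((Subgroup.mul_mem_cancel_left _ hu).1 h)
    simp only [F, if_neg this]
    simp
  have mp : ∀ u ∈ A, ∀ v ∈ A, (u * v) ^ s = u ^ s * v ^ s := fun u hu v hv =>
    Commute.mul_pow (zcomm hu hv) s
  have ex : ∀ x, x ∉ A → ∃ u ∈ A, x = u * g := fun x hx => ⟨x * g⁻¹, hcoset x hx, by group⟩
  let f : G →* G := MonoidHom.mk' F (by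
    intro x y
    by_cases hx : x ∈ A
    · by_cases hy : y ∈ A
      · rw [F1 _ hx, F1 _ hy, F1 _ (Subgroup.mul_mem _ hx hy), mp x hx y hy]
      · obtain ⟨v, hv, rfl⟩ := ex y hy
        rw [← mul_assoc, F2 _ (Subgroup.mul_mem _ hx hv), F1 _ hx, F2 _ hv, mp x hx v hv, mul_assoc]
    · obtain ⟨u, hu, rfl⟩ := ex x hx
      by_cases hy : y ∈ A
      · have hc := hn.conj_mem y hy g
        have e : u * g * y = u * (g * y * g⁻¹) * g := by group
        rw [e, F2 _ (Subgroup.mul_mem _ hu hc), F2 _ hu, F1 _ hy, mp _ hu _ hc, mul_assoc (u ^ s) (g ^ s),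
          hconj _ (Subgroup.pow_mem _ hy s), conj_pow, mul_assoc]
      · obtain ⟨v, hv, rfl⟩ := ex y hy
        have hc := hn.conj_mem v hv g
        have e : u * g * (v * g) = u * (g * v * g⁻¹) * (g * g) := by group
        rw [e, F1 _ (Subgroup.mul_mem _ (Subgroup.mul_mem _ hu hc) hgg), F2 _ hu, F2 _ hv,
          mp _ (Subgroup.mul_mem _ hu hc) _ hgg, mp _ hu _ hc, Commute.mul_pow (Commute.refl g)]
        have := hconj _ (Subgroup.pow_mem _ hv s)
        calc _ = u ^ s * ((g * v * g⁻¹) ^ s * g ^ s) * g ^ s := by group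
          _ = u ^ s * (g ^ s * v ^ s) * g ^ s := by rw [this, conj_pow]
          _ = _ := by group)
  have finj : Function.Injective f := by
    rw [injective_iff_map_eq_one]
    intro x hx
    change F x = 1 at hx
    by_cases hxA : x ∈ A
    · rw [F1 _ hxA] at hx
      exact (hG.powEquiv hs).injective (by simpa using hx)
    · obtain ⟨u, hu, rfl⟩ := ex x hxA
      rw [F2 _ hu] at hx
      exfalso
      apply hgs
      exact (Subgroup.mul_mem_cancel_left _ (Subgroup.pow_mem _ hu s)).1 (hx ▸ Subgroup.one_mem _)
  exact ⟨MulEquiv.ofBijective f (Finite.injective_iff_bijective.1 finj), F1 a (Subgroup.mem_zpowers a)⟩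

end Genotype
namespace Genotype

set_option linter.unusedSectionVars false

section
variable {k : Type} [Field k] [CharZero k] {G : Type} [Group G]
  {V : Type} [AddCommGroup V] [Module k V] [FiniteDimensional k V]
  {W : Type} [AddCommGroup W] [Module k W] [FiniteDimensional k W]

def RIrr (ρ : Representation k G V) : Prop :=
  Nontrivial V ∧ ∀ U : Submodule k V, (∀ g : G, ∀ x ∈ U, ρ g x ∈ U) → U = ⊥ ∨ U = ⊤

theorem mem_inv_iff {H : Type} [Group H] {X Y : Type} [AddCommGroup X] [Module k X] [AddCommGroup Y] [Module k Y]
    {ρ : Representation k H X} {σ : Representation k H Y} {T : X →ₗ[k] Y} :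
    T ∈ (Representation.linHom ρ σ).invariants ↔ ∀ g v, T (ρ g v) = σ g (T v) := by
  constructor
  · intro h g v
    have h1 := LinearMap.congr_fun (h g) (ρ g v)
    simp only [Representation.linHom_apply, LinearMap.comp_apply] at h1
    rw [← h1]
    simp
  · intro h g
    ext v
    simp only [Representation.linHom_apply, LinearMap.comp_apply]
    rw [h, ← Module.End.mul_apply, ← map_mul]; simp

theorem fix_zero_s8 [Finite G] {ρ : Representation k G V} (hi : RIrr ρ) (hf : Function.Injective ρ) {a : G}
    (hn : (Subgroup.zpowers a).Normal) {b : G} (hb : b ∈ Subgroup.zpowers a) (hb1 : b ≠ 1)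
    {v : V} (hv : ρ b v = v) : v = 0 := by
  have hinv : ∀ g : G, ∀ x ∈ LinearMap.ker (ρ b - 1), ρ g x ∈ LinearMap.ker (ρ b - 1) := by
    intro g x hx
    simp only [LinearMap.mem_ker, LinearMap.sub_apply, Module.End.one_apply, sub_eq_zero] at hx ⊢
    obtain ⟨t, ht⟩ := conj_exp hn g⁻¹
    have h1 := conj_pow_aux ht hb
    have h2 : b * g = g * b ^ t := by rw [← h1]; group
    have h3 : ∀ i : ℕ, (ρ b ^ i) x = x := by
      intro i
      induction i with
      | zero => simp
      | succ i ih => rw [pow_succ, Module.End.mul_apply, hx, ih]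
    rw [← Module.End.mul_apply, ← map_mul, h2, map_mul, Module.End.mul_apply, map_pow, h3]
  rcases hi.2 _ hinv with h | h
  · have : v ∈ LinearMap.ker (ρ b - 1) := by simp [hv]
    rw [h] at this; simpa using this
  · exfalso
    apply hb1
    apply hf
    rw [LinearMap.ker_eq_top, sub_eq_zero] at h
    rw [h, map_one]

theorem vanish [Finite G] {ρ : Representation k G V} (hi : RIrr ρ) (hf : Function.Injective ρ) {a : G}
    (hn : (Subgroup.zpowers a).Normal)
    (hC : ∀ g : G, g * a = a * g → g ∈ Subgroup.zpowers a) {g : G} (hg : g ∉ Subgroup.zpowers a) :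
    ρ.character g = 0 := by
  set d := a * (g * a⁻¹ * g⁻¹) with hd
  have hdA : d ∈ Subgroup.zpowers a := Subgroup.mul_mem _ (Subgroup.mem_zpowers a)
    (hn.conj_mem _ (Subgroup.inv_mem _ (Subgroup.mem_zpowers a)) g)
  have hd1 : d ≠ 1 := by
    intro h
    apply hg
    apply hC
    have : a * g = d * (g * a) := by rw [hd]; group
    rw [this, h, one_mul]
  have hconj : ∀ i : ℕ, ρ.character (d ^ i * g) = ρ.character g := by
    intro i
    have : d ^ i * g = a ^ i * g * (a ^ i)⁻¹ := by
      induction i with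
      | zero => simp
      | succ i ih =>
        have hc : d ^ i * a = a * d ^ i := zcomm (Subgroup.pow_mem _ hdA i) (Subgroup.mem_zpowers a)
        calc d ^ (i+1) * g = d ^ i * a * (g * a⁻¹) := by rw [pow_succ, hd]; group
          _ = a * (d ^ i * g) * a⁻¹ := by rw [hc]; group
          _ = _ := by rw [ih, pow_succ']; group
    rw [this, ρ.char_conj]
  have hsum : ∑ i ∈ Finset.range (orderOf d), ρ (d ^ i) = 0 := by
    ext v
    rw [LinearMap.zero_apply]
    apply fix_zero_s8 hi hf hn hdA hd1
    rw [← Module.End.mul_apply]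
    congr 1
    rw [Finset.mul_sum]
    simp only [← map_mul, ← pow_succ']
    have h1 := Finset.sum_range_succ' (fun i => ρ (d ^ i)) (orderOf d)
    have h2 := Finset.sum_range_succ (fun i => ρ (d ^ i)) (orderOf d)
    rw [h1] at h2
    simpa [pow_orderOf_eq_one] using h2
  have h3 : ∑ i ∈ Finset.range (orderOf d), ρ.character (d ^ i * g) = 0 := by
    simp only [Representation.character, map_mul]
    rw [← map_sum, ← Finset.sum_mul, hsum]; simp
  simp only [hconj, Finset.sum_const, Finset.card_range, nsmul_eq_mul] at h3
  rcases mul_eq_zero.1 h3 with h | h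
  · exact absurd h (by exact_mod_cast (orderOf_pos d).ne')
  · exact h

theorem char_eq_of_hom [Fintype G] {ρ : Representation k G V} (hi : RIrr ρ) (hf : Function.Injective ρ)
    {σ : Representation k G W} (hi' : RIrr σ) (hf' : Function.Injective σ) {a : G}
    (hn : (Subgroup.zpowers a).Normal)
    (hC : ∀ g : G, g * a = a * g → g ∈ Subgroup.zpowers a)
    (T : V →ₗ[k] W) (hT : T ≠ 0)
    (hTa : ∀ g ∈ Subgroup.zpowers a, ∀ v, T (ρ g v) = σ g (T v)) : ρ.character = σ.character := by
  let A := Subgroup.zpowers a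
  let ρA : Representation k A V := ρ.comp A.subtype
  let σA : Representation k A W := σ.comp A.subtype
  have : Invertible (Nat.card G : k) := invertibleOfNonzero (by exact_mod_cast Nat.card_pos.ne')
  have : Invertible (Nat.card A : k) := invertibleOfNonzero (by exact_mod_cast Nat.card_pos.ne')
  have e1 := Representation.card_inv_mul_sum_char_mul_char_eq_finrank ρ σ
  have e2 := Representation.card_inv_mul_sum_char_mul_char_eq_finrank ρA σA
  have hs : ∑ g : G, σ.character g * ρ.character g⁻¹ = ∑ g : A, σA.character g * ρA.character g⁻¹ := by
    have : ∑ g : A, σA.character g * ρA.character g⁻¹ =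
        ∑ g : A, (fun g : G => σ.character g * ρ.character g⁻¹) g := rfl
    rw [this, ← Finset.sum_subtype (Finset.univ.filter (· ∈ A)) (by simp)
      (fun g : G => σ.character g * ρ.character g⁻¹)]
    symm
    apply Finset.sum_subset (Finset.subset_univ _)
    intro x _ hx
    rw [vanish hi' hf' hn hC (by simpa using hx), zero_mul]
  have hA0 : ∑ g : A, σA.character g * ρA.character g⁻¹ ≠ 0 := by
    intro h
    rw [h, mul_zero] at e2
    have h0 : Module.finrank k (ρA.IntertwiningMap σA) = 0 := by exact_mod_cast e2.symm
    rw [← (Representation.invariantsEquivIntertwiningMap ρA σA).finrank_eq] at h0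
    have h1 := Submodule.finrank_eq_zero.1 h0
    have hm : T ∈ (Representation.linHom ρA σA).invariants := by
      rw [mem_inv_iff]
      intro g v
      exact hTa g g.2 v
    rw [h1] at hm
    exact hT (by simpa using hm)
  have hG0 : Module.finrank k (ρ.IntertwiningMap σ) ≠ 0 := by
    intro h
    rw [h, hs] at e1
    simp only [Nat.cast_zero, mul_eq_zero, inv_eq_zero] at e1
    rcases e1 with h | h
    · exact absurd h (by exact_mod_cast Nat.card_pos.ne')
    · exact hA0 h
  rw [← (Representation.invariantsEquivIntertwiningMap ρ σ).finrank_eq] at hG0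
  have hne : (Representation.linHom ρ σ).invariants ≠ ⊥ := fun h => hG0 (by rw [h]; simp)
  obtain ⟨S, hS, hS0⟩ := Submodule.exists_mem_ne_zero_of_ne_bot hne
  rw [mem_inv_iff] at hS
  have hSg : ∀ g v, S (ρ g v) = σ g (S v) := hS
  have hker : LinearMap.ker S = ⊥ := by
    rcases hi.2 (LinearMap.ker S) (fun g x hx => by
      rw [LinearMap.mem_ker] at hx ⊢; rw [hSg, hx, map_zero]) with h | h
    · exact h
    · exact absurd (LinearMap.ker_eq_top.1 h) hS0
  have hran : LinearMap.range S = ⊤ := by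
    rcases hi'.2 (LinearMap.range S) (fun g x hx => by
      obtain ⟨y, rfl⟩ := hx; exact ⟨ρ g y, hSg g y⟩) with h | h
    · exact absurd (LinearMap.range_eq_bot.1 h) hS0
    · exact h
  let E : V ≃ₗ[k] W := LinearEquiv.ofBijective S ⟨LinearMap.ker_eq_bot.1 hker, LinearMap.range_eq_top.1 hran⟩
  ext g
  have : σ g = E.conj (ρ g) := by
    ext w
    obtain ⟨v, rfl⟩ := E.surjective w
    rw [LinearEquiv.conj_apply_apply, E.symm_apply_apply]
    exact (hSg g v).symm
  rw [Representation.character, Representation.character, this, LinearMap.trace_conj']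

open Polynomial in
theorem exists_irr_factor [Nontrivial V] (φ : Module.End k V) :
    ∃ f : k[X], Irreducible f ∧ ∃ v : V, v ≠ 0 ∧ aeval φ f v = 0 := by
  have hint : IsIntegral k φ := Algebra.IsIntegral.isIntegral φ
  obtain ⟨f, hf, hd⟩ := WfDvdMonoid.exists_irreducible_factor
    (minpoly.not_isUnit k φ) (minpoly.ne_zero hint)
  refine ⟨f, hf, ?_⟩
  obtain ⟨h, hh⟩ := hd
  have h0 : h ≠ 0 := by rintro rfl; exact minpoly.ne_zero hint (by simpa using hh)
  have hne : aeval φ h ≠ 0 := by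
    intro e
    have h1 := minpoly.degree_le_of_ne_zero k φ h0 e
    rw [hh, degree_mul] at h1
    have h2 := hf.degree_pos
    rw [degree_eq_natDegree h0, degree_eq_natDegree hf.ne_zero] at h1
    rw [degree_eq_natDegree hf.ne_zero] at h2
    norm_cast at h1 h2
    omega
  obtain ⟨w, hw⟩ : ∃ w, aeval φ h w ≠ 0 := by
    by_contra hcon
    push Not at hcon
    exact hne (LinearMap.ext hcon)
  refine ⟨aeval φ h w, hw, ?_⟩
  rw [← Module.End.mul_apply, ← map_mul, ← hh, minpoly.aeval, LinearMap.zero_apply]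

open Polynomial in
theorem dvd_of_kill {f q : k[X]} (hf : Irreducible f) {φ : Module.End k V} {v : V} (hv : v ≠ 0)
    (h1 : aeval φ f v = 0) (h2 : aeval φ q v = 0) : f ∣ q := by
  by_contra h
  obtain ⟨α, β, hαβ⟩ := (hf.coprime_iff_not_dvd).2 h
  apply hv
  have := congrArg (fun r => aeval φ r v) hαβ
  simp only [map_add, map_mul, LinearMap.add_apply, Module.End.mul_apply, h1, h2, map_zero, map_one,
    Module.End.one_apply, add_zero] at this
  exact this.symm

open Polynomial in
theorem kill_of_dvd {f q : k[X]} {φ : Module.End k V} {v : V} 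
    (h1 : aeval φ f v = 0) (h2 : f ∣ q) : aeval φ q v = 0 := by
  obtain ⟨r, rfl⟩ := h2
  rw [mul_comm, map_mul, Module.End.mul_apply, h1, map_zero]

open Polynomial in
theorem exists_hom [Fintype G] {ρ : Representation k G V} {σ : Representation k G W} {a : G}
    {f : k[X]} (hf : Irreducible f) {v : V} (hv : v ≠ 0) (hfv : aeval (ρ a) f v = 0)
    {w : W} (hw : w ≠ 0) (hfw : aeval (σ a) f w = 0) :
    ∃ T : V →ₗ[k] W, T ≠ 0 ∧ ∀ g ∈ Subgroup.zpowers a, ∀ v, T (ρ g v) = σ g (T v) := by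
  let α : k[X] →ₗ[k] V := (LinearMap.applyₗ v).comp (aeval (ρ a)).toLinearMap
  let β : k[X] →ₗ[k] W := (LinearMap.applyₗ w).comp (aeval (σ a)).toLinearMap
  have hα : ∀ q, α q = aeval (ρ a) q v := fun q => rfl
  have hβ : ∀ q, β q = aeval (σ a) q w := fun q => rfl
  have hk : LinearMap.ker α ≤ LinearMap.ker β := by
    intro q hq
    rw [LinearMap.mem_ker] at hq ⊢
    exact kill_of_dvd hfw (dvd_of_kill hf hv hfv hq)
  obtain ⟨T₀, hT₀⟩ : ∃ T₀ : V →ₗ[k] W, ∀ q, T₀ (α q) = β q := by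
    let γ : LinearMap.range α →ₗ[k] W := ((LinearMap.ker α).liftQ β hk).comp
      (α.quotKerEquivRange.symm : LinearMap.range α →ₗ[k] _)
    obtain ⟨T₀, h⟩ := LinearMap.exists_extend γ
    refine ⟨T₀, fun q => ?_⟩
    have h1 := LinearMap.congr_fun h ⟨α q, q, rfl⟩
    simp only [LinearMap.comp_apply, Submodule.subtype_apply] at h1
    rw [h1]
    simp only [γ, LinearMap.comp_apply, LinearEquiv.coe_coe]
    have h2 : α.quotKerEquivRange.symm ⟨α q, q, rfl⟩ = Submodule.Quotient.mk q := by
      rw [LinearEquiv.symm_apply_eq]; rfl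
    rw [h2]; rfl
  let A := Subgroup.zpowers a
  let ρA : Representation k A V := ρ.comp A.subtype
  let σA : Representation k A W := σ.comp A.subtype
  have hpow : ∀ g ∈ A, T₀ (ρ g v) = σ g w := by
    intro g hg
    rw [← mem_powers_iff_mem_zpowers] at hg
    obtain ⟨n, rfl⟩ := hg
    have := hT₀ (X ^ n)
    simpa [hα, hβ] using this
  let T : V →ₗ[k] W := ∑ g : A, (Representation.linHom ρA σA g) T₀
  have hTinv : T ∈ (Representation.linHom ρA σA).invariants := by
    intro h
    simp only [T, map_sum, ← Module.End.mul_apply, ← map_mul]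
    exact Fintype.sum_equiv (Equiv.mulLeft h) _ _ (fun _ => rfl)
  refine ⟨T, ?_, ?_⟩
  · intro h
    have h1 : T v = (Nat.card A : k) • w := by
      simp only [T, LinearMap.sum_apply, Representation.linHom_apply, LinearMap.comp_apply]
      have : ∀ g : A, σA g (T₀ (ρA g⁻¹ v)) = w := by
        intro g
        have h2 : T₀ (ρA g⁻¹ v) = σ (g⁻¹ : A) w := hpow _ (g⁻¹).2
        rw [h2]
        change (σ g) (σ (g⁻¹ : A) w) = w
        rw [← Module.End.mul_apply, ← map_mul]; simp
      simp only [this]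
      simp [Nat.card_eq_fintype_card, Nat.cast_smul_eq_nsmul]
    rw [h] at h1
    rw [LinearMap.zero_apply, eq_comm, smul_eq_zero] at h1
    rcases h1 with h | h
    · exact absurd h (by exact_mod_cast Nat.card_pos.ne')
    · exact hw h
  · rw [mem_inv_iff] at hTinv
    intro g hg x
    exact hTinv ⟨g, hg⟩ x

open Polynomial in
theorem prim_root [Finite G] {ρ : Representation k G V} (hi : RIrr ρ) (hfa : Function.Injective ρ) {a : G}
    (hn : (Subgroup.zpowers a).Normal) {f : k[X]} (hf : Irreducible f) {v : V} (hv : v ≠ 0)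
    (hfv : aeval (ρ a) f v = 0) {ζ : AlgebraicClosure k} (hζ : aeval ζ f = 0) :
    IsPrimitiveRoot ζ (orderOf a) := by
  have key : ∀ m : ℕ, f ∣ X ^ m - 1 ↔ ρ (a ^ m) v = v := by
    intro m
    constructor
    · intro h
      have := kill_of_dvd hfv h
      simpa [sub_eq_zero] using this
    · intro h
      apply dvd_of_kill hf hv hfv
      simpa [sub_eq_zero] using h
  constructor
  · obtain ⟨r, hr⟩ := (key (orderOf a)).2 (by simp [pow_orderOf_eq_one])
    have := congrArg (aeval ζ) hr
    simpa [hζ, sub_eq_zero] using this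
  · intro l hl
    have hd : f ∣ X ^ l - 1 := by
      rw [← hf.dvd_iff_aeval_eq_zero hζ]
      simp [hl]
    have h1 := (key l).1 hd
    by_contra hne
    exact hv (fix_zero_s8 hi hfa hn (Subgroup.pow_mem _ (Subgroup.mem_zpowers a) l)
      (fun h => hne (orderOf_dvd_of_pow_eq_one h)) h1)

end
end Genotype
namespace Genotype

/-- If `G` is a Roquette `p`-group, then `Aut(G)` acts transitively on the isomorphism
classes of faithful `𝕂G`-irreps (an automorphism `θ` acting by precomposition). -/
theorem aut_transitive_on_faithful_irreps (p : ℕ) (hp : p.Prime)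
    (G : Type) [Group G] [Fintype G] (hG : IsPGroup p G)
    (k : Type) [Field k] [CharZero k] (hR : IsRoquette G)
    (ψ ψ' : FDRep k G) (hψ : IsIrr ψ) (hψf : IsFaithfulRep ψ)
    (hψ' : IsIrr ψ') (hψ'f : IsFaithfulRep ψ') :
    ∃ θ : G ≃* G, ψ'.character = fun g => ψ.character (θ g) := by
  have : Fact p.Prime := ⟨hp⟩
  obtain ⟨a, hn, hC, hind⟩ := struct hG hR
  have hi : RIrr ψ.ρ := hψ
  have hi' : RIrr ψ'.ρ := hψ'
  have := hψ.1
  have := hψ'.1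
  obtain ⟨f, hf, v, hv, hfv⟩ := exists_irr_factor (ψ.ρ a)
  obtain ⟨f', hf', v', hv', hfv'⟩ := exists_irr_factor (ψ'.ρ a)
  obtain ⟨ζ, hζ⟩ := IsAlgClosed.exists_aeval_eq_zero (AlgebraicClosure k) f hf.degree_pos.ne'
  obtain ⟨ζ', hζ'⟩ := IsAlgClosed.exists_aeval_eq_zero (AlgebraicClosure k) f' hf'.degree_pos.ne'
  have hr := prim_root hi hψf hn hf hv hfv hζ
  have hr' := prim_root hi' hψ'f hn hf' hv' hfv' hζ'
  obtain ⟨s, hs, hζs⟩ : ∃ s : ℕ, p.Coprime s ∧ ζ ^ s = ζ' := by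
    by_cases ha : a = 1
    · subst ha
      refine ⟨1, by simp, ?_⟩
      rw [orderOf_one] at hr hr'
      rw [IsPrimitiveRoot.one_right_iff.1 hr, IsPrimitiveRoot.one_right_iff.1 hr', one_pow]
    · have : NeZero (orderOf a) := ⟨(orderOf_pos a).ne'⟩
      obtain ⟨i, _, hi, h⟩ := hr.isPrimitiveRoot_iff.1 hr'
      exact ⟨i, (Nat.Coprime.coprime_dvd_right (hG.dvd_orderOf ha) hi).symm, h⟩
  obtain ⟨θ, hθ⟩ := exists_aut hG hn hind s hs
  refine ⟨θ, ?_⟩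
  let ρ : Representation k G ψ := MonoidHom.comp ψ.ρ θ.toMonoidHom
  have hρ : ∀ g, ρ g = ψ.ρ (θ g) := fun g => rfl
  have hρi : RIrr ρ := ⟨hψ.1, fun U hU => hψ.2 U (fun g x hx => by
    have := hU (θ.symm g) x hx
    rwa [hρ, θ.apply_symm_apply] at this)⟩
  have hρf : Function.Injective ρ := fun x y hxy => θ.injective (hψf hxy)
  have hkill : Polynomial.aeval (ρ a) f' v = 0 := by
    have hd : f ∣ f'.comp (Polynomial.X ^ s) := by
      rw [← hf.dvd_iff_aeval_eq_zero hζ, Polynomial.aeval_comp]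
      simp [hζs, hζ']
    have := kill_of_dvd hfv hd
    rw [Polynomial.aeval_comp] at this
    rw [hρ, hθ, map_pow]
    simpa using this
  obtain ⟨T, hT0, hT⟩ := exists_hom (ρ := ρ) (σ := ψ'.ρ) hf' hv hkill hv' hfv'
  have := char_eq_of_hom hρi hρf hi' hψ'f hn hC T hT0 hT
  exact this.symm

end Genotype
end
end

section
/- If G is a Roquette p-group, then the faithful 𝕂G-irreps comprise a single Galois conjugacy class: for any two faithful 𝕂G-irreps ψ and ψ', there is a field automorphism α of the subfield of 𝕂 generated over ℚ by the character values of ψ such that α(ψ(g)) = ψ'(g) for all g ∈ G. -/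
open scoped Classical

noncomputable section

namespace Genotype

lemma aux_closure_comm {G : Type} [Group G] {S : Set G} (h : ∀ x ∈ S, ∀ y ∈ S, x * y = y * x) :
    ∀ x ∈ Subgroup.closure S, ∀ y ∈ Subgroup.closure S, x * y = y * x := by
  have h1 : S ⊆ Subgroup.centralizer (Subgroup.closure S : Set G) := by
    intro x hx
    rw [Subgroup.centralizer_closure, SetLike.mem_coe, Subgroup.mem_centralizer_iff]
    intro y hy
    exact h y hy x hx
  have h2 := (Subgroup.closure_le _).2 h1
  intro x hx y hy
  exact (Subgroup.mem_centralizer_iff.1 (h2 hx) y hy).symm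

lemma aux_closure_normal {G : Type} [Group G] {S : Set G}
    (h : ∀ x ∈ S, ∀ g : G, g * x * g⁻¹ ∈ Subgroup.closure S) : (Subgroup.closure S).Normal := by
  constructor
  intro n hn g
  have : Subgroup.closure S ≤ (Subgroup.closure S).comap (MulAut.conj g).toMonoidHom := by
    rw [Subgroup.closure_le]
    intro x hx
    exact h x hx g
  exact this hn

lemma aux_self_centralizing {p : ℕ} (hp : p.Prime) {G : Type} [Group G] [Finite G]
    (hG : IsPGroup p G) : ∃ A : Subgroup G, A.Normal ∧ (∀ x ∈ A, ∀ y ∈ A, x * y = y * x) ∧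
      ∀ x, (∀ y ∈ A, x * y = y * x) → x ∈ A := by
  have : Fact p.Prime := ⟨hp⟩
  have : Group.IsNilpotent G := hG.isNilpotent
  obtain ⟨A, hA⟩ := (Set.toFinite {A : Subgroup G | A.Normal ∧
    (∀ x ∈ A, ∀ y ∈ A, x * y = y * x)}).exists_maximal ⟨⊥, inferInstance, by simp⟩
  obtain ⟨⟨hN, hC⟩, hmax⟩ := hA
  refine ⟨A, hN, hC, ?_⟩
  by_contra hcon
  push Not at hcon
  obtain ⟨x0, hx0, hx0A⟩ := hcon
  have hex : ∃ j, ∀ x ∈ Subgroup.lowerCentralSeries (⊤ : Subgroup G) j, (∀ y ∈ A, x * y = y * x) → x ∈ A := by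
    obtain ⟨j, hj⟩ := Subgroup.nilpotent_iff_lowerCentralSeries.1 ‹Group.IsNilpotent G›
    refine ⟨j, fun x hx _ => ?_⟩
    rw [hj, Subgroup.mem_bot] at hx
    rw [hx]; exact A.one_mem
  classical
  obtain ⟨hj1, hj2⟩ := Nat.find_spec hex, @Nat.find_min _ _ hex
  rcases hj : Nat.find hex with _ | j
  · rw [hj] at hj1
    exact hx0A (hj1 x0 (by simp) hx0)
  have := hj2 (m := j) (by omega)
  rw [hj] at hj1
  push Not at this
  obtain ⟨x, hxj, hxc, hxA⟩ := this
  have key : ∀ g : G, g * x * g⁻¹ * x⁻¹ ∈ A := by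
    intro g
    apply hj1
    · have : x * g * x⁻¹ * g⁻¹ ∈ Subgroup.lowerCentralSeries (⊤ : Subgroup G) (j+1) := by
        rw [Subgroup.lowerCentralSeries_succ]
        exact Subgroup.subset_closure ⟨x, hxj, g, Subgroup.mem_top _, rfl⟩
      have := inv_mem this
      simpa [mul_assoc] using this
    · intro y hy
      have h1 := hxc y hy
      have h2 := hxc _ (hN.conj_mem y hy g⁻¹)
      have h3 : x⁻¹ * y = y * x⁻¹ := by rw [inv_mul_eq_iff_eq_mul, ← mul_assoc, h1]; group
      calc g * x * g⁻¹ * x⁻¹ * y = g * x * g⁻¹ * (x⁻¹ * y) := by group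
        _ = g * (x * (g⁻¹ * y * g⁻¹⁻¹)) * g⁻¹ * x⁻¹ := by rw [h3]; group
        _ = _ := by rw [h2]; group
  have hle := hmax (y := Subgroup.closure (insert x (A : Set G))) ⟨?_, ?_⟩ ?_
  · exact hxA (hle (Subgroup.subset_closure (Set.mem_insert _ _)))
  · apply aux_closure_normal
    rintro y (rfl | hy) g
    · have : g * y * g⁻¹ = (g * y * g⁻¹ * y⁻¹) * y := by group
      rw [this]
      exact mul_mem (Subgroup.subset_closure (Set.mem_insert_of_mem _ (key g)))
        (Subgroup.subset_closure (Set.mem_insert _ _))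
    · exact Subgroup.subset_closure (Set.mem_insert_of_mem _ (hN.conj_mem y hy g))
  · apply aux_closure_comm
    rintro y (rfl | hy) z (rfl | hz)
    · rfl
    · exact hxc z hz
    · exact (hxc y hy).symm
    · exact hC y hy z hz
  · intro y hy
    exact Subgroup.subset_closure (Set.mem_insert_of_mem _ hy)

/-- number theory: geometric sum -/
lemma aux_geom {p : ℕ} (hp : p.Prime) {s : ℤ} (h1 : (p : ℤ) ∣ s - 1) (h2 : p = 2 → (4 : ℤ) ∣ s - 1) :
    ∃ u : ℤ, ∑ i ∈ Finset.range p, s ^ i = p * u ∧ IsCoprime u (p : ℤ) := by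
  have hp' : Prime (p : ℤ) := Nat.prime_iff_prime_int.1 hp
  have hcop : ∀ u : ℤ, ¬ (p : ℤ) ∣ u → IsCoprime u (p : ℤ) := fun u hu =>
    (((Prime.coprime_iff_not_dvd hp').2 hu)).symm
  rcases hp.eq_two_or_odd' with rfl | hodd
  · obtain ⟨w, hw⟩ := h2 rfl
    refine ⟨1 + 2 * w, ?_, ?_⟩
    · simp [Finset.sum_range_succ]; linarith
    · apply hcop
      push_cast
      omega
  · have hs : ¬ (p : ℤ) ∣ s := by
      intro h
      have := dvd_sub h h1
      simp at this
      exact hp'.not_isUnit (isUnit_of_dvd_one this)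
    have := emultiplicity_geom_sum₂_eq_one (R := ℤ) hp' hodd h1 hs
    simp only [one_pow, mul_one] at this
    obtain ⟨u, hu⟩ : (p : ℤ) ∣ ∑ i ∈ Finset.range p, s ^ i := by
      apply dvd_of_emultiplicity_pos; rw [this]; simp
    refine ⟨u, hu, hcop _ ?_⟩
    rintro ⟨v, rfl⟩
    have h3 : (p : ℤ) ^ 2 ∣ ∑ i ∈ Finset.range p, s ^ i := ⟨v, by rw [hu]; ring⟩
    have := le_emultiplicity_of_pow_dvd h3
    rw [‹emultiplicity _ _ = 1›] at this
    norm_num at this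
end Genotype

namespace Genotype
section
variable {G : Type} [Group G]

lemma aux_conj_pow {a g : G} {s : ℤ} (h : g * a * g⁻¹ = a ^ s) (i : ℤ) :
    g * a ^ i * g⁻¹ = a ^ (s * i) := by
  rw [zpow_mul, ← h, conj_zpow]

lemma aux_conj_comm {a g : G} {s : ℤ} (h : g * a * g⁻¹ = a ^ s) (i : ℤ) :
    g * a ^ i = a ^ (s * i) * g := by
  rw [← aux_conj_pow h]; group

lemma aux_conj_iter {a g : G} {s : ℤ} (h : g * a * g⁻¹ = a ^ s) (j : ℕ) :
    g ^ j * a * (g ^ j)⁻¹ = a ^ (s ^ j) := by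
  induction j with
  | zero => simp
  | succ j ih =>
    have : g ^ (j+1) * a * (g ^ (j+1))⁻¹ = g * (g ^ j * a * (g ^ j)⁻¹) * g⁻¹ := by
      rw [pow_succ']; group
    rw [this, ih, aux_conj_pow h, pow_succ']

lemma aux_norm {a g : G} {s : ℤ} (h : g * a * g⁻¹ = a ^ s) (i : ℤ) (j : ℕ) :
    (a ^ i * g) ^ j = a ^ (i * ∑ l ∈ Finset.range j, s ^ l) * g ^ j := by
  induction j with
  | zero => simp
  | succ j ih =>
    rw [pow_succ', ih, Finset.sum_range_succ']
    have := aux_conj_comm h (i * ∑ l ∈ Finset.range j, s ^ l)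
    calc a ^ i * g * (a ^ (i * ∑ l ∈ Finset.range j, s ^ l) * g ^ j)
        = a ^ i * (g * a ^ (i * ∑ l ∈ Finset.range j, s ^ l)) * g ^ j := by group
      _ = a ^ (i + s * (i * ∑ l ∈ Finset.range j, s ^ l)) * (g * g ^ j) := by
          rw [this, zpow_add]; group
      _ = _ := by
          rw [← pow_succ']
          congr 2
          simp only [pow_succ', ← Finset.mul_sum]
          ring

lemma aux_key {p : ℕ} (hp : p.Prime) [Finite G] (hR : ∀ A : Subgroup G, A.Normal →
      (∀ x ∈ A, ∀ y ∈ A, x * y = y * x) → IsCyclic A)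
    {a : G} {m : ℕ} (ha : orderOf a = p ^ m) (hn : ∀ g : G, ∃ s : ℤ, g * a * g⁻¹ = a ^ s)
    (hc : ∀ g : G, g * a * g⁻¹ = a → g ∈ Subgroup.zpowers a)
    {g : G} {s : ℤ} (hg : g ∉ Subgroup.zpowers a) (hgp : g ^ p ∈ Subgroup.zpowers a)
    (hs : g * a * g⁻¹ = a ^ s) (h1 : (p : ℤ) ∣ s - 1) (h2 : p = 2 → (4 : ℤ) ∣ s - 1) : False := by
  obtain ⟨u, hu, hcop⟩ := aux_geom hp h1 h2
  have hp' : Prime (p : ℤ) := Nat.prime_iff_prime_int.1 hp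
  have hpz : (p : ℤ) ≠ 0 := hp'.ne_zero
  have hord : ∀ i : ℤ, a ^ i = 1 ↔ (p : ℤ) ^ m ∣ i := by
    intro i
    rw [← orderOf_dvd_iff_zpow_eq_one, ha]; push_cast; rfl
  have hmul : (∑ l ∈ Finset.range p, s ^ l) * (s - 1) = s ^ p - 1 := geom_sum_mul s p
  obtain ⟨j, hj⟩ := Subgroup.mem_zpowers_iff.1 hgp
  have hsm : ¬ (p : ℤ) ^ m ∣ s - 1 := by
    intro h
    apply hg (hc g _)
    rw [hs]
    have := (hord _).2 h
    rw [zpow_sub, zpow_one] at this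
    exact mul_inv_eq_one.1 this
  have hsp : (p : ℤ) ^ m ∣ s ^ p - 1 := by
    rw [← hord, zpow_sub, zpow_one, ← aux_conj_iter hs, ← hj]
    group
  have hm1 : m ≠ 0 := by
    rintro rfl
    simp at hsm
  have hm2 : 2 ≤ m := by
    by_contra hlt
    have : m = 1 := by omega
    subst this
    simp at hsm
    exact hsm h1
  obtain ⟨q, rfl⟩ : ∃ q, m = q + 2 := ⟨m - 2, by omega⟩
  have hdiv : ∀ e : ℤ, (p : ℤ) ^ (q + 2) ∣ e * (p * u) → (p : ℤ) ^ (q + 1) ∣ e := by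
    intro e he
    rw [pow_succ, show e * (p * u) = (e * u) * p by ring] at he
    have := (mul_dvd_mul_iff_right hpz).1 he
    exact (IsCoprime.pow_left hcop.symm).dvd_of_dvd_mul_right this
  have hs1 : (p : ℤ) ^ (q + 1) ∣ s - 1 := by
    apply hdiv
    rw [← hu, mul_comm, hmul]; exact hsp
  have hpj : (p : ℤ) ∣ j := by
    by_contra hpj
    apply hsm
    have hcj : IsCoprime ((p : ℤ) ^ (q + 2)) j :=
      IsCoprime.pow_left ((Prime.coprime_iff_not_dvd hp').2 hpj)
    apply hcj.dvd_of_dvd_mul_right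
    rw [← hord, sub_mul, one_mul, zpow_sub, ← aux_conj_pow hs, hj]
    group
  obtain ⟨j', rfl⟩ := hpj
  obtain ⟨x, y, hxy⟩ : IsCoprime u ((p : ℤ) ^ (q + 2)) := hcop.pow_right
  set i : ℤ := - j' * x with hi
  set h : G := a ^ i * g with hh
  have hhp : h ^ p = 1 := by
    rw [hh, aux_norm hs, hu, ← hj, ← zpow_add, hord]
    refine ⟨p * j' * y, ?_⟩
    rw [hi]
    linear_combination -(p * j' : ℤ) * hxy
  have hhA : h ∉ Subgroup.zpowers a := by
    intro hh'
    apply hg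
    have : g = (a ^ i)⁻¹ * h := by rw [hh]; group
    rw [this]
    exact mul_mem (inv_mem (Subgroup.zpow_mem_zpowers _ _)) hh'
  have hhs : h * a * h⁻¹ = a ^ s := by
    have : h * a * h⁻¹ = a ^ i * (g * a * g⁻¹) * (a ^ i)⁻¹ := by rw [hh]; group
    rw [this, hs]; group
  have hhc : h * a ^ (p : ℤ) = a ^ (p : ℤ) * h := by
    rw [aux_conj_comm hhs]
    congr 1
    rw [← mul_inv_eq_one, ← zpow_neg, ← zpow_add, hord]
    obtain ⟨w, hw⟩ := hs1
    exact ⟨w, by rw [pow_succ]; linear_combination p * hw⟩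
  set B := Subgroup.closure ({h, a ^ (p : ℤ)} : Set G) with hB
  have hhB : h ∈ B := Subgroup.subset_closure (by simp)
  have haB : a ^ (p : ℤ) ∈ B := Subgroup.subset_closure (by simp)
  have hBn : B.Normal := by
    apply aux_closure_normal
    rintro y (rfl | hy) x
    · obtain ⟨r, hr⟩ := hn x
      have hcomm : x * h * x⁻¹ * h⁻¹ ∈ Subgroup.zpowers a := by
        apply hc
        have e1 : h⁻¹ * a ^ s * h = a := by rw [← hhs]; group
        have e2 : x⁻¹ * a ^ r * x = a := by rw [← hr]; group
        -- show  x h a = [x,h] h x a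
        have e3 : (x * h) * a * (x * h)⁻¹ = a ^ (r * s) := by
          rw [← aux_conj_pow hr, ← hhs]; group
        have e4 : (h * x) * a * (h * x)⁻¹ = a ^ (r * s) := by
          rw [mul_comm, ← aux_conj_pow hhs, ← hr]; group
        have e5 : a = (h * x)⁻¹ * a ^ (r * s) * (h * x) := by rw [← e4]; group
        have e6 : ∀ c : G, (c * (h * x)) * a * (c * (h * x))⁻¹ = a ^ (r * s) →
            c * a ^ (r * s) * c⁻¹ = a ^ (r * s) := by
          intro c hc'
          refine Eq.trans ?_ hc'
          rw [← e4]; group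
        have e7 := e6 (x * h * x⁻¹ * h⁻¹) (by rw [← e3]; group)
        obtain ⟨r', hr'⟩ := hn (h * x)⁻¹
        have e8 : a = a ^ (r * s * r') := by
          rw [mul_comm, ← aux_conj_pow hr']; rw [← e4]; group
        calc _ = (x * h * x⁻¹ * h⁻¹) * a ^ (r * s * r') * (x * h * x⁻¹ * h⁻¹)⁻¹ := by rw [← e8]
          _ = ((x * h * x⁻¹ * h⁻¹) * a ^ (r * s) * (x * h * x⁻¹ * h⁻¹)⁻¹) ^ r' := by
              rw [zpow_mul, conj_zpow]
          _ = a := by rw [e7, ← zpow_mul, ← e8]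
      obtain ⟨e, he⟩ := Subgroup.mem_zpowers_iff.1 hcomm
      have e1 : x * h * x⁻¹ = a ^ e * h := by rw [he]; group
      have e2 : (a ^ e * h) ^ p = 1 := by rw [← e1, conj_pow, hhp]; group
      rw [aux_norm hhs, hhp, mul_one, hord, hu] at e2
      have e3 := hdiv e e2
      obtain ⟨w, hw⟩ := dvd_trans (dvd_pow_self (p : ℤ) (by omega)) e3
      rw [e1, hw, zpow_mul]
      exact mul_mem (zpow_mem haB _) hhB
    · rw [Set.mem_singleton_iff] at hy
      obtain ⟨r, hr⟩ := hn x
      rw [hy, aux_conj_pow hr, mul_comm, zpow_mul]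
      exact zpow_mem haB _
  have hBc : ∀ x ∈ B, ∀ y ∈ B, x * y = y * x := by
    apply aux_closure_comm
    rintro y (rfl | hy) z (rfl | hz)
    · rfl
    · rw [Set.mem_singleton_iff] at hz; rw [hz, hhc]
    · rw [Set.mem_singleton_iff] at hy; rw [hy, hhc]
    · rw [Set.mem_singleton_iff] at hy hz; rw [hy, hz]
  have hcyc := hR B hBn hBc
  classical
  have := Fintype.ofFinite B
  have hle := IsCyclic.card_pow_eq_one_le (α := B) hp.pos
  set z : B := ⟨a ^ (p : ℤ), haB⟩ ^ (p ^ q) with hz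
  have hzv : (z : G) = a ^ (p ^ (q + 1)) := by
    rw [hz]; push_cast; rw [zpow_natCast, ← pow_mul, ← pow_succ']
  have hzo : orderOf z = p := by
    rw [← Subgroup.orderOf_coe, hzv, orderOf_pow' _ (pow_ne_zero _ hp.ne_zero), ha,
      Nat.gcd_eq_right (pow_dvd_pow _ (by omega)), pow_succ p (q+1), mul_comm,
      Nat.mul_div_cancel _ (pow_pos hp.pos _)]
  have hsub : insert (⟨h, hhB⟩ : B) ((Finset.range p).image (fun i => z ^ i)) ⊆
      Finset.univ.filter (fun x : B => x ^ p = 1) := by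
    intro x hx
    simp only [Finset.mem_filter, Finset.mem_univ, true_and]
    rw [Finset.mem_insert, Finset.mem_image] at hx
    rcases hx with rfl | ⟨i, _, rfl⟩
    · exact Subtype.ext hhp
    · rw [← pow_mul, mul_comm, pow_mul, ← hzo, pow_orderOf_eq_one, one_pow]
  have hcard := Finset.card_le_card hsub
  rw [Finset.card_insert_of_notMem, Finset.card_image_of_injOn, Finset.card_range] at hcard
  · omega
  · intro i hi j hj hij
    simp only [Finset.coe_range, Set.mem_Iio] at hi hj
    exact pow_injOn_Iio_orderOf (by rw [hzo]; exact hi) (by rw [hzo]; exact hj) hij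
  · rw [Finset.mem_image]
    rintro ⟨i, _, hi⟩
    apply hhA
    have := congrArg Subtype.val hi
    simp only [Subgroup.coe_pow, hzv] at this
    rw [← this]
    exact pow_mem (pow_mem (Subgroup.mem_zpowers a) _) _
end
end Genotype

namespace Genotype
section
variable {G : Type} [Group G]

lemma aux_mem {p : ℕ} (hp : p.Prime) [Finite G] (hG : IsPGroup p G)
    (hR : ∀ A : Subgroup G, A.Normal →
      (∀ x ∈ A, ∀ y ∈ A, x * y = y * x) → IsCyclic A)
    {a : G} {m : ℕ} (ha : orderOf a = p ^ m) (hn : ∀ g : G, ∃ s : ℤ, g * a * g⁻¹ = a ^ s)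
    (hc : ∀ g : G, g * a * g⁻¹ = a → g ∈ Subgroup.zpowers a)
    {g : G} {s : ℤ}
    (hs : g * a * g⁻¹ = a ^ s) (h1 : (p : ℤ) ∣ s - 1) (h2 : p = 2 → (4 : ℤ) ∣ s - 1) :
    g ∈ Subgroup.zpowers a := by
  by_contra hg
  have hex : ∃ k, g ^ (p ^ k) ∈ Subgroup.zpowers a := by
    obtain ⟨k, hk⟩ := hG g
    exact ⟨k, hk ▸ one_mem _⟩
  classical
  obtain ⟨hj1, hj2⟩ := Nat.find_spec hex, @Nat.find_min _ _ hex
  rcases hj : Nat.find hex with _ | j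
  · rw [hj] at hj1
    simp at hj1
    exact hg (Subgroup.mem_zpowers_iff.2 hj1)
  have := hj2 (m := j) (by omega)
  rw [hj] at hj1
  have hd : s - 1 ∣ s ^ (p ^ j) - 1 := by simpa using sub_dvd_pow_sub_pow s 1 (p ^ j)
  exact aux_key hp hR ha hn hc this (by rw [← pow_mul, ← pow_succ]; exact hj1)
    (aux_conj_iter hs (p ^ j)) (h1.trans hd) (fun h => (h2 h).trans hd)

lemma aux_struct {p : ℕ} (hp : p.Prime) [Finite G] (hG : IsPGroup p G)
    (hR : ∀ A : Subgroup G, A.Normal →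
      (∀ x ∈ A, ∀ y ∈ A, x * y = y * x) → IsCyclic A)
    {a : G} {m : ℕ} (ha : orderOf a = p ^ m) (hn : ∀ g : G, ∃ s : ℤ, g * a * g⁻¹ = a ^ s)
    (hc : ∀ g : G, g * a * g⁻¹ = a → g ∈ Subgroup.zpowers a) :
    (∀ g, g ∈ Subgroup.zpowers a) ∨ (p = 2 ∧
      (∀ x y, x ∉ Subgroup.zpowers a → y ∉ Subgroup.zpowers a → x * y ∈ Subgroup.zpowers a) ∧
      ∀ g, g ∉ Subgroup.zpowers a → (g * g) * (g * g) = 1) := by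
  have hp' : Prime (p : ℤ) := Nat.prime_iff_prime_int.1 hp
  have hord : ∀ i : ℤ, a ^ i = 1 ↔ (p : ℤ) ^ m ∣ i := by
    intro i
    rw [← orderOf_dvd_iff_zpow_eq_one, ha]; push_cast; rfl
  rcases Nat.eq_zero_or_pos m with rfl | hm
  · left
    intro g
    apply hc
    rw [pow_zero, orderOf_eq_one_iff] at ha
    rw [ha]; group
  have hall : ∀ (g : G) (s : ℤ), g * a * g⁻¹ = a ^ s → (p : ℤ) ∣ s - 1 := by
    intro g s hs
    obtain ⟨k, hk⟩ := hG g
    have h1 := aux_conj_iter hs (p ^ k)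
    rw [hk] at h1
    have h2 : a ^ (s ^ (p ^ k) - 1) = 1 := by
      rw [zpow_sub, ← h1]; group
    rw [hord] at h2
    have h3 : (p : ℤ) ∣ s ^ (p ^ k) - 1 := (dvd_pow_self _ hm.ne').trans h2
    have := Fact.mk hp
    rw [← ZMod.intCast_zmod_eq_zero_iff_dvd] at h3 ⊢
    push_cast at h3 ⊢
    rwa [ZMod.pow_card_pow] at h3
  rcases hp.eq_two_or_odd' with rfl | hodd
  · right
    have h3 : ∀ (g : G) (s : ℤ), g * a * g⁻¹ = a ^ s → g ∉ Subgroup.zpowers a → s % 4 = 3 := by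
      intro g s hs hg
      have h1 := hall g s hs
      have h2 : ¬ (4 : ℤ) ∣ s - 1 := fun h =>
        hg (aux_mem hp hG hR ha hn hc hs h1 (fun _ => h))
      push_cast at h1
      omega
    have hprod : ∀ x y, x ∉ Subgroup.zpowers a → y ∉ Subgroup.zpowers a →
        x * y ∈ Subgroup.zpowers a := by
      intro x y hx hy
      obtain ⟨s, hs⟩ := hn x
      obtain ⟨r, hr⟩ := hn y
      have hsr : (x * y) * a * (x * y)⁻¹ = a ^ (s * r) := by
        rw [← aux_conj_pow hs, ← hr]; group
      have e1 := h3 x s hs hx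
      have e2 := h3 y r hr hy
      have e3 : (4 : ℤ) ∣ s * r - 1 := by
        have : (s * r) % 4 = 1 := by rw [Int.mul_emod, e1, e2]; rfl
        omega
      exact aux_mem hp hG hR ha hn hc hsr (hall _ _ hsr) (fun _ => e3)
    refine ⟨rfl, hprod, ?_⟩
    intro g hg
    obtain ⟨s, hs⟩ := hn g
    have e1 := h3 g s hs hg
    obtain ⟨j, hj⟩ := Subgroup.mem_zpowers_iff.1 (hprod g g hg hg)
    have e2 : a ^ (j * (s - 1)) = 1 := by
      rw [mul_sub, mul_one, zpow_sub, mul_comm j s, ← aux_conj_pow hs, hj]; group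
    rw [hord] at e2
    obtain ⟨w, hw⟩ : ∃ w, s - 1 = 2 * (2 * w + 1) := ⟨s / 4, by omega⟩
    rw [hw, show j * (2 * (2 * w + 1)) = (j + j) * (2 * w + 1) by ring] at e2
    have e3 : IsCoprime (((2 : ℕ) : ℤ) ^ m) (2 * w + 1) := by
      apply IsCoprime.pow_left
      exact ⟨-w, 1, by push_cast; ring⟩
    rw [← hj, ← zpow_add, hord]
    exact e3.dvd_of_dvd_mul_right e2
  · left
    intro g
    obtain ⟨s, hs⟩ := hn g
    refine aux_mem hp hG hR ha hn hc hs (hall g s hs) ?_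
    rintro rfl
    exact absurd hodd (by decide)

/-- the automorphism -/
lemma aux_theta {p : ℕ} (hp : p.Prime) [Finite G] (hG : IsPGroup p G)
    (hR : ∀ A : Subgroup G, A.Normal →
      (∀ x ∈ A, ∀ y ∈ A, x * y = y * x) → IsCyclic A)
    {a : G} {m : ℕ} (ha : orderOf a = p ^ m) (hn : ∀ g : G, ∃ s : ℤ, g * a * g⁻¹ = a ^ s)
    (hc : ∀ g : G, g * a * g⁻¹ = a → g ∈ Subgroup.zpowers a)
    {t : ℕ} (ht : t.Coprime (p ^ m)) :
    ∃ θ : G ≃* G, θ a = a ^ t ∧ ∀ x, x ∉ Subgroup.zpowers a → θ x ∉ Subgroup.zpowers a := by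
  classical
  have hinjA : ∀ x ∈ Subgroup.zpowers a, x ^ t = 1 → x = 1 := by
    intro x hx hxt
    have h1 := orderOf_dvd_of_pow_eq_one hxt
    have h2 : orderOf x ∣ p ^ m := by
      rw [← ha, ← Nat.card_zpowers a, ← Subgroup.orderOf_mk x hx]
      exact orderOf_dvd_natCard _
    have := Nat.eq_one_of_dvd_coprimes ht h1 h2
    exact orderOf_eq_one_iff.1 this
  have hcomm : ∀ x ∈ Subgroup.zpowers a, ∀ y ∈ Subgroup.zpowers a, Commute x y := by
    intro x hx y hy
    obtain ⟨i, rfl⟩ := hx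
    obtain ⟨j, rfl⟩ := hy
    exact (Commute.refl a).zpow_zpow i j
  suffices H : ∃ θ : G →* G, (∀ x ∈ Subgroup.zpowers a, θ x = x ^ t) ∧
      ∀ x, x ∉ Subgroup.zpowers a → θ x ∉ Subgroup.zpowers a by
    obtain ⟨θ, h1, h2⟩ := H
    have hinj : Function.Injective θ := by
      rw [injective_iff_map_eq_one]
      intro x hx
      by_cases hxa : x ∈ Subgroup.zpowers a
      · rw [h1 x hxa] at hx
        exact hinjA x hxa hx
      · exact absurd (hx ▸ one_mem _) (h2 x hxa)
    exact ⟨MulEquiv.ofBijective θ (Finite.injective_iff_bijective.1 hinj),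
      h1 a (Subgroup.mem_zpowers a), h2⟩
  have hAll : (∀ g, g ∈ Subgroup.zpowers a) → ∃ θ : G →* G, (∀ x ∈ Subgroup.zpowers a, θ x = x ^ t) ∧
      ∀ x, x ∉ Subgroup.zpowers a → θ x ∉ Subgroup.zpowers a := by
    intro hall
    refine ⟨⟨⟨fun x => x ^ t, one_pow _⟩, fun x y => (hcomm x (hall x) y (hall y)).mul_pow t⟩,
      fun x _ => rfl, fun x hx => absurd (hall x) hx⟩
  rcases aux_struct hp hG hR ha hn hc with hall | ⟨rfl, h2, h4⟩
  · exact hAll hall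
  by_cases hall : ∀ g, g ∈ Subgroup.zpowers a
  · exact hAll hall
  push Not at hall
  obtain ⟨g, hg⟩ := hall
  obtain ⟨s, hs⟩ := hn g
  have hm : m ≠ 0 := by
    rintro rfl
    apply hg
    apply hc
    rw [pow_zero, orderOf_eq_one_iff] at ha
    rw [ha]; group
  have htodd : Odd t := by
    rw [← Nat.not_even_iff_odd, even_iff_two_dvd]
    intro h
    have := Nat.eq_one_of_dvd_coprimes ht h (dvd_pow_self 2 hm)
    omega
  have hggA := h2 g g hg hg
  have hggt : (g * g) ^ t = g * g := by
    obtain ⟨r, rfl⟩ := htodd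
    rw [pow_succ, pow_mul, pow_two, h4 g hg, one_pow, one_mul]
  have hconjA : ∀ x ∈ Subgroup.zpowers a, g * x * g⁻¹ ∈ Subgroup.zpowers a := by
    rintro x ⟨i, rfl⟩
    exact Subgroup.mem_zpowers_iff.2 ⟨s * i, (aux_conj_pow hs i).symm⟩
  have hinvg : g⁻¹ ∉ Subgroup.zpowers a := fun h => hg (by simpa using inv_mem h)
  have hxg : ∀ x, x ∉ Subgroup.zpowers a → x * g⁻¹ ∈ Subgroup.zpowers a := fun x hx => h2 x _ hx hinvg
  set f : G → G := fun x => if x ∈ Subgroup.zpowers a then x ^ t else (x * g⁻¹) ^ t * g with hf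
  have f1 : ∀ x ∈ Subgroup.zpowers a, f x = x ^ t := fun x hx => by simp only [hf, if_pos hx]
  have f2 : ∀ x ∈ Subgroup.zpowers a, f (x * g) = x ^ t * g := fun x hx => by
    have : x * g ∉ Subgroup.zpowers a := fun h => hg ((Subgroup.mul_mem_cancel_left _ hx).1 h)
    simp only [hf, if_neg this]
    group
  have hdec : ∀ x, x ∈ Subgroup.zpowers a ∨ ∃ y ∈ Subgroup.zpowers a, x = y * g := by
    intro x
    by_cases hx : x ∈ Subgroup.zpowers a
    · exact Or.inl hx
    · exact Or.inr ⟨x * g⁻¹, hxg x hx, by group⟩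
  have hmul : ∀ x y, f (x * y) = f x * f y := by
    intro x y
    rcases hdec x with hx | ⟨x, hx, rfl⟩ <;> rcases hdec y with hy | ⟨y, hy, rfl⟩
    · rw [f1 _ hx, f1 _ hy, f1 _ (mul_mem hx hy), (hcomm x hx y hy).mul_pow]
    · rw [f1 _ hx, f2 _ hy, ← mul_assoc, f2 _ (mul_mem hx hy), (hcomm x hx y hy).mul_pow, mul_assoc]
    · have e : x * g * y = (x * (g * y * g⁻¹)) * g := by group
      rw [e, f2 _ hx, f1 _ hy, f2 _ (mul_mem hx (hconjA y hy)),
        (hcomm x hx _ (hconjA y hy)).mul_pow, conj_pow]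
      group
    · have e : x * g * (y * g) = (x * (g * y * g⁻¹)) * (g * g) := by group
      rw [e, f2 _ hx, f2 _ hy, f1 _ (mul_mem (mul_mem hx (hconjA y hy)) hggA),
        (hcomm _ (mul_mem hx (hconjA y hy)) _ hggA).mul_pow,
        (hcomm x hx _ (hconjA y hy)).mul_pow, conj_pow, hggt]
      group
  refine ⟨⟨⟨f, by rw [f1 _ (one_mem _), one_pow]⟩, hmul⟩, f1, ?_⟩
  intro x hx
  rcases hdec x with h | ⟨y, hy, rfl⟩
  · exact absurd h hx
  · change f _ ∉ _
    rw [f2 y hy]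
    intro h
    exact hg ((Subgroup.mul_mem_cancel_left _ (pow_mem hy t)).1 h)
end
end Genotype

namespace Genotype
section
open Module Polynomial

lemma aux_trace0 {E U : Type} [Field E] [CharZero E] [IsAlgClosed E]
    [AddCommGroup U] [Module E U] [FiniteDimensional E U] (F : End E U) {n : ℕ} (hn : 0 < n)
    (hFn : F ^ n = 1) :
    ∃ (S : Finset E) (μ : E → ℕ), (∀ η ∈ S, 0 < μ η) ∧
      (∀ i : ℕ, LinearMap.trace E U (F ^ i) = ∑ η ∈ S, (μ η : E) * η ^ i) ∧
      (∀ η ∈ S, η ^ n = 1 ∧ ∀ d : ℕ, IsUnit (F ^ d - 1) → η ^ d ≠ 1) := by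
  classical
  have hss : F.IsSemisimple := by
    apply Module.End.isSemisimple_of_squarefree_aeval_eq_zero (p := X ^ n - 1)
    · apply Polynomial.Separable.squarefree
      rw [Polynomial.X_pow_sub_one_separable_iff]
      exact_mod_cast hn.ne'
    · simp [hFn]
  have hint := DirectSum.isInternal_submodule_of_iSupIndep_of_iSup_eq_top
    (Module.End.eigenspaces_iSupIndep F) hss.iSup_eigenspace_eq_top
  have hfin : {η | F.eigenspace η ≠ ⊥}.Finite := Module.End.finite_hasEigenvalue F
  have hpow : ∀ (i : ℕ) (η : E) (v : U), v ∈ F.eigenspace η → (F ^ i) v = η ^ i • v := by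
    intro i η v hv
    rw [Module.End.mem_eigenspace_iff] at hv
    induction i with
    | zero => simp
    | succ i ih => rw [pow_succ', Module.End.mul_apply, ih, map_smul, hv, smul_smul, pow_succ]
  refine ⟨hfin.toFinset, fun η => finrank E (F.eigenspace η), ?_, ?_, ?_⟩
  · intro η hη
    rw [Set.Finite.mem_toFinset] at hη
    have := Submodule.nontrivial_iff_ne_bot.2 hη
    exact finrank_pos (R := E) (M := F.eigenspace η)
  · intro i
    have hmaps : ∀ η, Set.MapsTo (F ^ i) (F.eigenspace η) (F.eigenspace η) := by
      intro η v hv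
      rw [hpow i η v hv]
      exact Submodule.smul_mem _ _ hv
    rw [LinearMap.trace_eq_sum_trace_restrict' hint hfin hmaps]
    refine Finset.sum_congr rfl fun η _ => ?_
    have e2 : (F ^ i).restrict (hmaps η) = η ^ i • LinearMap.id := by
      refine LinearMap.ext fun v => Subtype.ext ?_
      exact hpow i η v v.2
    rw [e2, map_smul, LinearMap.trace_id, smul_eq_mul, mul_comm]
  · intro η hη
    rw [Set.Finite.mem_toFinset] at hη
    obtain ⟨v, hv, hv0⟩ := Submodule.exists_mem_ne_zero_of_ne_bot hη
    constructor
    · have := hpow n η v hv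
      rw [hFn, Module.End.one_apply] at this
      have h2 : (η ^ n - 1) • v = 0 := by rw [sub_smul, one_smul, ← this, sub_self]
      exact sub_eq_zero.1 ((smul_eq_zero.1 h2).resolve_right hv0)
    · intro d hu2 hηd
      obtain ⟨g, hg⟩ := hu2.exists_left_inv
      apply hv0
      have h3 : (g * (F ^ d - 1)) v = v := by rw [hg]; rfl
      rw [← h3, Module.End.mul_apply, LinearMap.sub_apply, hpow d η v hv, hηd]
      simp

lemma aux_trace {k E : Type} [Field k] [Field E] [CharZero E] [Algebra k E] [IsAlgClosed E]
    {V : Type} [AddCommGroup V] [Module k V]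
    [FiniteDimensional k V] (f : End k V) {n : ℕ} (hn : 0 < n) (hf : f ^ n = 1) :
    ∃ (S : Finset E) (μ : E → ℕ), (∀ η ∈ S, 0 < μ η) ∧
      (∀ i : ℕ, algebraMap k E (LinearMap.trace k V (f ^ i)) =
        ∑ η ∈ S, (μ η : E) * η ^ i) ∧
      (∀ η ∈ S, η ^ n = 1 ∧ ∀ d : ℕ, (∀ v, (f ^ d) v = v → v = 0) → η ^ d ≠ 1) ∧
      (Nontrivial V → S.Nonempty) := by
  set F : End E (TensorProduct k E V) := Module.End.baseChangeHom k E V f with hF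
  have hFn : F ^ n = 1 := by rw [hF, ← map_pow, hf, map_one]
  obtain ⟨S, μ, h1, h2, h3⟩ := aux_trace0 F hn hFn
  have htr : ∀ i : ℕ, algebraMap k E (LinearMap.trace k V (f ^ i)) =
        ∑ η ∈ S, (μ η : E) * η ^ i := by
    intro i
    rw [← LinearMap.trace_baseChange, ← h2 i]
    have e1 : LinearMap.baseChange E (f ^ i) = F ^ i := by
      rw [hF, ← map_pow]; rfl
    rw [e1]
  refine ⟨S, μ, h1, htr, fun η hη => ⟨(h3 η hη).1, fun d hd => (h3 η hη).2 d ?_⟩, ?_⟩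
  · have hu : IsUnit (f ^ d - 1) := by
      rw [LinearMap.isUnit_iff_ker_eq_bot, LinearMap.ker_eq_bot']
      intro w hw
      apply hd
      simpa [sub_eq_zero] using hw
    have hu2 := hu.map (Module.End.baseChangeHom k E V)
    rw [map_sub, map_pow, map_one, ← hF] at hu2
    exact hu2
  · intro hV
    rw [Finset.nonempty_iff_ne_empty]
    intro h0
    have := htr 0
    rw [h0, pow_zero, LinearMap.trace_one] at this
    simp only [Finset.sum_empty, map_natCast, Nat.cast_eq_zero] at this
    exact (finrank_pos (R := k) (M := V)).ne' this

lemma aux_fixed {k G V : Type} [Field k] [Group G] [AddCommGroup V] [Module k V]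
    (ρ : Representation k G V)
    (hirr : ∀ U : Submodule k V, (∀ g : G, ∀ x ∈ U, ρ g x ∈ U) → U = ⊥ ∨ U = ⊤)
    (hfaith : Function.Injective ρ) {a : G} (hn : ∀ g : G, ∃ s : ℤ, g * a * g⁻¹ = a ^ s)
    {c : G} (hc : c ∈ Subgroup.zpowers a) (hc1 : c ≠ 1) (v : V) (hv : ρ c v = v) : v = 0 := by
  obtain ⟨j, rfl⟩ := hc
  have hz : ∀ (i : ℤ) (v : V), ρ (a ^ j) v = v → ρ ((a ^ j) ^ i) v = v := by
    intro i v hv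
    have hinv : ρ (a ^ j)⁻¹ v = v := by
      conv_lhs => rw [← hv]
      simp [← Module.End.mul_apply, ← map_mul]
    have hnat : ∀ (g : G), ρ g v = v → ∀ m : ℕ, ρ (g ^ m) v = v := by
      intro g hg m
      induction m with
      | zero => simp
      | succ m ih => rw [pow_succ, map_mul, Module.End.mul_apply, hg, ih]
    obtain ⟨m, rfl | rfl⟩ := i.eq_nat_or_neg
    · rw [zpow_natCast]; exact hnat _ hv m
    · rw [zpow_neg, zpow_natCast, ← inv_pow]; exact hnat _ hinv m
  have hk := hirr (LinearMap.ker (ρ (a ^ j) - 1)) (by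
    intro g x hx
    simp only [LinearMap.mem_ker, LinearMap.sub_apply, Module.End.one_apply, sub_eq_zero] at hx ⊢
    obtain ⟨s, hs⟩ := hn g⁻¹
    have e : a ^ j * g = g * (a ^ j) ^ s := by
      have := aux_conj_pow hs j
      rw [← zpow_mul, mul_comm j s, ← this]; group
    rw [← Module.End.mul_apply, ← map_mul]
    change ρ (a ^ j * g) x = _
    rw [e, map_mul, Module.End.mul_apply, hz s x hx])
  rcases hk with h | h
  · have : v ∈ LinearMap.ker (ρ (a ^ j) - 1) := by simp [hv, sub_eq_zero]
    rw [h] at this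
    simpa using this
  · exfalso
    apply hc1
    apply hfaith
    rw [LinearMap.ker_eq_top, sub_eq_zero] at h
    rw [map_one]; exact h

lemma aux_vanish {k G V : Type} [Field k] [CharZero k] [Group G] [Finite G] [AddCommGroup V]
    [Module k V] (ρ : Representation k G V)
    (hirr : ∀ U : Submodule k V, (∀ g : G, ∀ x ∈ U, ρ g x ∈ U) → U = ⊥ ∨ U = ⊤)
    (hfaith : Function.Injective ρ) {a : G} (hn : ∀ g : G, ∃ s : ℤ, g * a * g⁻¹ = a ^ s)
    (hc : ∀ g : G, g * a * g⁻¹ = a → g ∈ Subgroup.zpowers a)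
    {g : G} (hg : g ∉ Subgroup.zpowers a) : LinearMap.trace k V (ρ g) = 0 := by
  obtain ⟨s, hs⟩ := hn g
  set c := a ^ (1 - s) with hcdef
  have hc1 : c ≠ 1 := by
    intro h
    apply hg (hc g _)
    rw [hs]
    rw [hcdef, zpow_sub, zpow_one, mul_inv_eq_one] at h
    exact h.symm
  have hcm : c ∈ Subgroup.zpowers a := Subgroup.zpow_mem_zpowers _ _
  have htr : ∀ i : ℕ, LinearMap.trace k V (ρ (c ^ i * g)) = LinearMap.trace k V (ρ g) := by
    intro i
    have e : c ^ i * g = a ^ (i : ℤ) * g * (a ^ (i : ℤ))⁻¹ := by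
      have := aux_conj_comm hs (-(i : ℤ))
      rw [← zpow_neg, mul_assoc, this, ← mul_assoc, ← zpow_add, hcdef, ← zpow_natCast, ← zpow_mul]
      congr 2; ring
    rw [e, map_mul, LinearMap.trace_mul_comm, ← map_mul]
    congr 2; group
  have hN := orderOf_pos c
  have hT : ∑ i ∈ Finset.range (orderOf c), ρ c ^ i = 0 := by
    ext v
    apply aux_fixed ρ hirr hfaith hn hcm hc1
    have h1 : (ρ c - 1) * ∑ i ∈ Finset.range (orderOf c), ρ c ^ i = 0 := by
      rw [mul_geom_sum, ← map_pow, pow_orderOf_eq_one, map_one, sub_self]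
    have h2 := LinearMap.congr_fun h1 v
    rw [Module.End.mul_apply, LinearMap.sub_apply, Module.End.one_apply] at h2
    exact sub_eq_zero.1 h2
  have h3 : LinearMap.trace k V ((∑ i ∈ Finset.range (orderOf c), ρ c ^ i) * ρ g) =
      orderOf c * LinearMap.trace k V (ρ g) := by
    rw [Finset.sum_mul, map_sum]
    rw [Finset.sum_congr rfl (fun i _ => by rw [← map_pow, ← map_mul, htr i])]
    simp
  rw [hT, zero_mul, map_zero] at h3
  have := (mul_eq_zero.1 h3.symm).resolve_left (by exact_mod_cast hN.ne')
  exact this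

lemma aux_schur {k G V W : Type} [Field k] [CharZero k] [Group G] [Fintype G]
    [AddCommGroup V] [Module k V] [FiniteDimensional k V]
    [AddCommGroup W] [Module k W] [FiniteDimensional k W]
    (ρ : Representation k G V) (σ : Representation k G W)
    (hρ : ∀ U : Submodule k V, (∀ g : G, ∀ x ∈ U, ρ g x ∈ U) → U = ⊥ ∨ U = ⊤)
    (hσ : ∀ U : Submodule k W, (∀ g : G, ∀ x ∈ U, σ g x ∈ U) → U = ⊥ ∨ U = ⊤)
    (hne : ∑ g : G, LinearMap.trace k W (σ g) * LinearMap.trace k V (ρ g⁻¹) ≠ 0) (g : G) :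
    LinearMap.trace k V (ρ g) = LinearMap.trace k W (σ g) := by
  have hcard : (Nat.card G : k) ≠ 0 := by exact_mod_cast Nat.card_pos.ne'
  have : Invertible (Nat.card G : k) := invertibleOfNonzero hcard
  have h1 := Representation.card_inv_mul_sum_char_mul_char_eq_finrank ρ σ
  have h2 : finrank k (Representation.IntertwiningMap ρ σ) ≠ 0 := by
    intro h0
    rw [h0, Nat.cast_zero, mul_eq_zero] at h1
    exact h1.elim (inv_ne_zero hcard) hne
  have h3 : ∃ f : Representation.IntertwiningMap ρ σ, f.toLinearMap ≠ 0 := by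
    by_contra hcon
    push Not at hcon
    apply h2
    have : Subsingleton (Representation.IntertwiningMap ρ σ) := by
      constructor
      intro f f'
      apply Representation.IntertwiningMap.ext
      rw [hcon f, hcon f']
    exact finrank_zero_of_subsingleton
  obtain ⟨⟨f, hf⟩, hf0⟩ := h3
  change f ≠ 0 at hf0
  have hf' : ∀ g x, f (ρ g x) = σ g (f x) := fun g x => LinearMap.congr_fun (hf g) x
  have hker : LinearMap.ker f = ⊥ := by
    refine (hρ _ ?_).resolve_right ?_
    · intro g x hx
      rw [LinearMap.mem_ker] at hx ⊢
      rw [hf', hx, map_zero]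
    · intro h; exact hf0 (LinearMap.ker_eq_top.1 h)
  have hran : LinearMap.range f = ⊤ := by
    refine (hσ _ ?_).resolve_left ?_
    · rintro g _ ⟨x, rfl⟩
      exact ⟨ρ g x, hf' g x⟩
    · intro h; exact hf0 (LinearMap.range_eq_bot.1 h)
  set e := LinearEquiv.ofBijective f ⟨LinearMap.ker_eq_bot.1 hker, LinearMap.range_eq_top.1 hran⟩
  have : σ g = e.conj (ρ g) := by
    ext w
    obtain ⟨v, rfl⟩ := e.surjective w
    rw [LinearEquiv.conj_apply_apply, LinearEquiv.symm_apply_apply]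
    exact (hf' g v).symm
  rw [this, LinearMap.trace_conj']

lemma aux_field {k E X : Type} [Field k] [Field E] (ι : k →+* E) (χ : X → k) (θ : X ≃ X)
    (L : Subfield E) (σ : L →+* E) (hL : ∀ x, ι (χ x) ∈ L)
    (hσ : ∀ x, σ ⟨ι (χ x), hL x⟩ = ι (χ (θ x))) :
    ∃ α : Subfield.closure (Set.range χ) ≃+* Subfield.closure (Set.range χ),
      ∀ x, ((α ⟨χ x, Subfield.subset_closure ⟨x, rfl⟩⟩ : Subfield.closure (Set.range χ)) : k)
        = χ (θ x) := by
  set F := Subfield.closure (Set.range χ) with hF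
  have hFL : ∀ x ∈ F, ι x ∈ L := by
    have : F ≤ L.comap ι := by
      rw [hF, Subfield.closure_le]
      rintro _ ⟨x, rfl⟩
      exact hL x
    exact fun x hx => this hx
  set f : F →+* E := σ.comp ((ι.comp F.subtype).codRestrict L (fun x => hFL x x.2)) with hf
  have hfgen : ∀ x, f ⟨χ x, Subfield.subset_closure ⟨x, rfl⟩⟩ = ι (χ (θ x)) := hσ
  have hex : ∀ x (hx : x ∈ F), ∃ y : F, ι y = f ⟨x, hx⟩ := by
    intro x hx
    induction hx using Subfield.closure_induction with
    | mem x h =>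
      obtain ⟨z, rfl⟩ := h
      exact ⟨⟨χ (θ z), Subfield.subset_closure ⟨_, rfl⟩⟩, (hfgen z).symm⟩
    | one => exact ⟨1, by
        rw [show (⟨1, _⟩ : F) = 1 from rfl]; simp⟩
    | add x y hx hy h1 h2 =>
      obtain ⟨a, ha⟩ := h1
      obtain ⟨b, hb⟩ := h2
      refine ⟨a + b, ?_⟩
      rw [show (⟨x + y, _⟩ : F) = ⟨x, hx⟩ + ⟨y, hy⟩ from rfl, map_add, ← ha, ← hb]; simp
    | neg x hx h1 =>
      obtain ⟨a, ha⟩ := h1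
      refine ⟨-a, ?_⟩
      rw [show (⟨-x, _⟩ : F) = -⟨x, hx⟩ from rfl, map_neg, ← ha]; simp
    | inv x hx h1 =>
      obtain ⟨a, ha⟩ := h1
      refine ⟨a⁻¹, ?_⟩
      rw [show (⟨x⁻¹, _⟩ : F) = (⟨x, hx⟩)⁻¹ from rfl, map_inv₀, ← ha]; simp
    | mul x y hx hy h1 h2 =>
      obtain ⟨a, ha⟩ := h1
      obtain ⟨b, hb⟩ := h2
      refine ⟨a * b, ?_⟩
      rw [show (⟨x * y, _⟩ : F) = ⟨x, hx⟩ * ⟨y, hy⟩ from rfl, map_mul, ← ha, ← hb]; simp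
  have hex' : ∀ x : F, ∃ y : F, ι y = f x := fun x => hex x x.2
  choose φ hφ using hex'
  have hinj : ∀ y z : F, ι y = ι z → y = z := fun y z h => Subtype.ext (ι.injective h)
  let Φ : F →+* F :=
    { toFun := φ
      map_one' := hinj _ _ (by rw [hφ]; simp)
      map_zero' := hinj _ _ (by rw [hφ]; simp)
      map_mul' := fun x y => hinj _ _ (by rw [hφ, map_mul, Subfield.coe_mul, map_mul, hφ, hφ])
      map_add' := fun x y => hinj _ _ (by rw [hφ, map_add, Subfield.coe_add, map_add, hφ, hφ]) }
  have hΦ : ∀ x, ((Φ ⟨χ x, Subfield.subset_closure ⟨x, rfl⟩⟩ : F) : k) = χ (θ x) := by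
    intro x
    apply ι.injective
    exact (hφ _).trans (hfgen x)
  have hsurj : Function.Surjective Φ := by
    have h1 : F ≤ (F.subtype.comp Φ).fieldRange := by
      refine Subfield.closure_le.2 ?_
      rintro _ ⟨x, rfl⟩
      refine ⟨⟨χ (θ.symm x), Subfield.subset_closure ⟨_, rfl⟩⟩, ?_⟩
      have := hΦ (θ.symm x)
      rw [Equiv.apply_symm_apply] at this
      exact this
    intro y
    obtain ⟨x, hx⟩ := h1 y.2
    exact ⟨x, Subtype.ext hx⟩
  exact ⟨RingEquiv.ofBijective Φ ⟨Φ.injective, hsurj⟩, hΦ⟩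

lemma aux_sigma0 {K E : Type} [Field K] [Field E] [Algebra K E] {n t : ℕ} (hn : 0 < n) {ζ : E}
    (hζ : IsPrimitiveRoot ζ n) (hmp : minpoly K ζ = minpoly K (ζ ^ t)) :
    ∃ (L : Subfield E) (σ : L →+* E), ∀ η : E, η ^ n = 1 → ∃ h : η ∈ L, σ ⟨η, h⟩ = η ^ t := by
  have hint : IsIntegral K ζ := (hζ.isIntegral hn).tower_top
  let pb := IntermediateField.adjoin.powerBasis hint
  have hgen : pb.gen = IntermediateField.AdjoinSimple.gen K ζ :=
    IntermediateField.adjoin.powerBasis_gen hint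
  have hmin : (aeval (ζ ^ t)) (minpoly K pb.gen) = 0 := by
    rw [hgen, IntermediateField.minpoly_gen, hmp, minpoly.aeval]
  let σ := pb.lift (ζ ^ t) hmin
  refine ⟨(IntermediateField.adjoin K {ζ}).toSubfield, σ.toRingHom, ?_⟩
  intro η hη
  have : NeZero n := ⟨hn.ne'⟩
  obtain ⟨i, _, rfl⟩ := hζ.eq_pow_of_pow_eq_one hη
  refine ⟨pow_mem (IntermediateField.mem_adjoin_simple_self K ζ) i, ?_⟩
  have h1 : σ pb.gen = ζ ^ t := pb.lift_gen _ hmin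
  have h2 : σ (pb.gen ^ i) = (ζ ^ i) ^ t := by rw [map_pow, h1, ← pow_mul, ← pow_mul, mul_comm]
  rw [← h2, hgen]
  rfl

lemma aux_sigma {E : Type} [Field E] [CharZero E] {n t : ℕ} (hn : 0 < n) {ζ : E}
    (hζ : IsPrimitiveRoot ζ n) (ht : t.Coprime n) :
    ∃ (L : Subfield E) (σ : L →+* E), ∀ η : E, η ^ n = 1 → ∃ h : η ∈ L, σ ⟨η, h⟩ = η ^ t := by
  have hζ' := hζ.pow_of_coprime t ht
  refine aux_sigma0 (K := ℚ) hn hζ ?_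
  rw [← Polynomial.cyclotomic_eq_minpoly_rat hζ hn,
      Polynomial.cyclotomic_eq_minpoly_rat hζ' hn]
end
end Genotype

namespace Genotype
section
open Module

lemma aux_eig {k E G V : Type} [Field k] [Field E] [CharZero E] [Algebra k E] [IsAlgClosed E]
    [Group G] [Finite G] [AddCommGroup V] [Module k V] [FiniteDimensional k V] [Nontrivial V]
    (ρ : Representation k G V)
    (hirr : ∀ U : Submodule k V, (∀ g : G, ∀ x ∈ U, ρ g x ∈ U) → U = ⊥ ∨ U = ⊤)
    (hfaith : Function.Injective ρ) {a : G} (hn : ∀ g : G, ∃ s : ℤ, g * a * g⁻¹ = a ^ s) :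
    ∃ (S : Finset E) (μ : E → ℕ), (∀ η ∈ S, 0 < μ η) ∧
      (∀ i : ℕ, algebraMap k E (LinearMap.trace k V (ρ (a ^ i))) =
        ∑ η ∈ S, (μ η : E) * η ^ i) ∧
      (∀ η ∈ S, IsPrimitiveRoot η (orderOf a)) ∧ S.Nonempty := by
  obtain ⟨S, μ, h1, h2, h3, h4⟩ := aux_trace (E := E) (ρ a) (orderOf_pos a)
    (by rw [← map_pow, pow_orderOf_eq_one, map_one])
  refine ⟨S, μ, h1, fun i => by rw [← h2 i, map_pow], fun η hη => ?_, h4 inferInstance⟩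
  refine IsPrimitiveRoot.mk_of_lt η (orderOf_pos a) (h3 η hη).1 fun l hl hln => ?_
  refine (h3 η hη).2 l fun v hv => ?_
  rw [← map_pow] at hv
  exact aux_fixed ρ hirr hfaith hn (Subgroup.npow_mem_zpowers a l)
    (pow_ne_one_of_lt_orderOf hl.ne' hln) v hv

lemma aux_geom_root {E : Type} [Field E] {x : E} {n : ℕ} (hx : x ^ n = 1) :
    ∑ i ∈ Finset.range n, x ^ i = ((open Classical in if x = 1 then n else 0 : ℕ) : E) := by
  split_ifs with h
  · simp [h]
  · rw [geom_sum_eq h, hx]; simp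

lemma aux_pair {k E G : Type} [Field k] [Field E] [CharZero E] [Algebra k E]
    [Group G] [Fintype G] (χ χ' : G → k) {a : G} {t : ℕ} (θ : G ≃* G) (hθ : θ a = a ^ t)
    (hv : ∀ g ∉ Subgroup.zpowers a, χ' g = 0)
    (S S' : Finset E) (μ μ' : E → ℕ) (hμ : ∀ η ∈ S, 0 < μ η) (hμ' : ∀ η ∈ S', 0 < μ' η)
    (hχ : ∀ i : ℕ, algebraMap k E (χ (a ^ i)) = ∑ η ∈ S, (μ η : E) * η ^ i)
    (hχ' : ∀ i : ℕ, algebraMap k E (χ' (a ^ i)) = ∑ η ∈ S', (μ' η : E) * η ^ i)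
    (hS : ∀ η ∈ S, η ^ (orderOf a) = 1) (hS' : ∀ η ∈ S', η ^ (orderOf a) = 1)
    {ζ : E} (hζ : ζ ∈ S) (hζ' : ζ ^ t ∈ S') :
    ∑ g : G, χ' g * χ (θ g⁻¹) ≠ 0 := by
  classical
  set n := orderOf a with hn
  have hpos : 0 < n := orderOf_pos a
  intro h0
  have h1 : ∑ g : G, χ' g * χ (θ g⁻¹) =
      ∑ i ∈ Finset.range n, χ' (a ^ i) * χ (a ^ (t * (n - 1) * i)) := by
    have e : ∀ i : ℕ, a ^ (t * (n - 1) * i) = θ (a ^ i)⁻¹ := by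
      intro i
      rw [map_inv, map_pow, hθ, eq_inv_iff_mul_eq_one, ← pow_mul, ← pow_add]
      have : t * (n - 1) * i + t * i = n * (t * i) := by
        obtain ⟨n', hn'⟩ := Nat.exists_eq_succ_of_ne_zero hpos.ne'
        rw [hn']; simp; ring
      rw [this, pow_mul, hn, pow_orderOf_eq_one, one_pow]
    simp only [e]
    rw [← Finset.sum_image (s := Finset.range n) (g := fun i : ℕ => a ^ i)
      (f := fun g => χ' g * χ (θ g⁻¹))]
    · symm
      apply Finset.sum_subset (Finset.subset_univ _)
      intro g _ hg
      rw [hv g, zero_mul]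
      intro hgm
      apply hg
      obtain ⟨i, hi, hia⟩ := (mem_zpowers_iff_mem_range_orderOf (x := a) (y := g)).1 hgm |> Finset.mem_image.1
      exact Finset.mem_image.2 ⟨i, hi, hia⟩
    · intro i hi j hj hij
      exact pow_injOn_Iio_orderOf (by simpa using hi) (by simpa using hj) hij
  rw [h1] at h0
  have h2 := congrArg (algebraMap k E) h0
  rw [map_zero, map_sum] at h2
  have h3 : ∀ i ∈ Finset.range n, algebraMap k E (χ' (a ^ i) * χ (a ^ (t * (n - 1) * i))) =
      ∑ η' ∈ S', ∑ η ∈ S, ((μ' η' * μ η : ℕ) : E) * (η' * η ^ (t * (n - 1))) ^ i := by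
    intro i _
    rw [map_mul, hχ, hχ', Finset.sum_mul_sum]
    refine Finset.sum_congr rfl fun η' _ => Finset.sum_congr rfl fun η _ => ?_
    rw [mul_pow, ← pow_mul]; push_cast; ring
  rw [Finset.sum_congr rfl h3, Finset.sum_comm] at h2
  have h4 : ∀ η' ∈ S', ∑ i ∈ Finset.range n, ∑ η ∈ S, ((μ' η' * μ η : ℕ) : E) * (η' * η ^ (t * (n - 1))) ^ i
      = ((∑ η ∈ S, (μ' η' * μ η) * (if η' * η ^ (t * (n - 1)) = 1 then n else 0) : ℕ) : E) := by
    intro η' hη'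
    rw [Finset.sum_comm, Nat.cast_sum]
    refine Finset.sum_congr rfl fun η hη => ?_
    have hone : (η' * η ^ (t * (n - 1))) ^ n = 1 := by
      rw [mul_pow, hS' η' hη', one_mul, ← pow_mul, mul_comm, pow_mul, hS η hη, one_pow]
    rw [← Finset.mul_sum, aux_geom_root hone, Nat.cast_mul _ (ite _ _ _)]
  rw [Finset.sum_congr rfl h4, ← Nat.cast_sum, Nat.cast_eq_zero, Finset.sum_eq_zero_iff] at h2
  have h5 := h2 _ hζ'
  rw [Finset.sum_eq_zero_iff] at h5
  have h6 := h5 _ hζ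
  have h7 : ζ ^ t * ζ ^ (t * (n - 1)) = 1 := by
    rw [← pow_add]
    have : t + t * (n - 1) = n * t := by
      obtain ⟨n', hn'⟩ := Nat.exists_eq_succ_of_ne_zero hpos.ne'
      rw [hn']; simp; ring
    rw [this, pow_mul, hS ζ hζ, one_pow]
  rw [if_pos h7] at h6
  have := hμ _ hζ
  have := hμ' _ hζ'
  have h8 : 0 < μ' (ζ ^ t) * μ ζ * n := by positivity
  exact h8.ne' h6

lemma aux_main {k G V V' : Type} [Field k] [CharZero k] [Group G] [Fintype G]
    {p : ℕ} (hp : p.Prime) (hG : IsPGroup p G)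
    (hR : ∀ A : Subgroup G, A.Normal → (∀ x ∈ A, ∀ y ∈ A, x * y = y * x) → IsCyclic A)
    [AddCommGroup V] [Module k V] [FiniteDimensional k V] [Nontrivial V]
    [AddCommGroup V'] [Module k V'] [FiniteDimensional k V'] [Nontrivial V']
    (ρ : Representation k G V) (ρ' : Representation k G V')
    (hirr : ∀ U : Submodule k V, (∀ g : G, ∀ x ∈ U, ρ g x ∈ U) → U = ⊥ ∨ U = ⊤)
    (hirr' : ∀ U : Submodule k V', (∀ g : G, ∀ x ∈ U, ρ' g x ∈ U) → U = ⊥ ∨ U = ⊤)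
    (hf : Function.Injective ρ) (hf' : Function.Injective ρ')
    (χ χ' : G → k) (hχ : ∀ g, χ g = LinearMap.trace k V (ρ g))
    (hχ' : ∀ g, χ' g = LinearMap.trace k V' (ρ' g)) :
    ∃ α : Subfield.closure (Set.range χ) ≃+* Subfield.closure (Set.range χ),
      ∀ x, ((α ⟨χ x, Subfield.subset_closure ⟨x, rfl⟩⟩ : Subfield.closure (Set.range χ)) : k)
        = χ' x := by
  classical
  obtain ⟨A, hAn, hAc, hAs⟩ := aux_self_centralizing hp hG
  obtain ⟨⟨a, haA⟩, hgen⟩ := (hR A hAn hAc).exists_generator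
  have hA : ∀ x, x ∈ A → x ∈ Subgroup.zpowers a := by
    intro x hx
    obtain ⟨i, hi⟩ := hgen ⟨x, hx⟩
    exact ⟨i, congrArg Subtype.val hi⟩
  have hn : ∀ g : G, ∃ s : ℤ, g * a * g⁻¹ = a ^ s := by
    intro g
    obtain ⟨s, hs⟩ := hA _ (hAn.conj_mem a haA g)
    exact ⟨s, hs.symm⟩
  have hc : ∀ g : G, g * a * g⁻¹ = a → g ∈ Subgroup.zpowers a := by
    intro g hg
    apply hA
    apply hAs
    intro y hy
    obtain ⟨i, rfl⟩ := hA y hy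
    have : Commute g a := mul_inv_eq_iff_eq_mul.1 hg
    exact this.zpow_right i
  have := Fact.mk hp
  obtain ⟨m, hm⟩ := (IsPGroup.iff_orderOf.1 hG) a
  let E := AlgebraicClosure k
  have : CharZero E := charZero_of_injective_algebraMap (algebraMap k E).injective
  obtain ⟨S, μ, hμ, hS, hprim, ζ, hζ⟩ := aux_eig (E := E) ρ hirr hf hn
  obtain ⟨S', μ', hμ', hS', hprim', ζ', hζ'⟩ := aux_eig (E := E) ρ' hirr' hf' hn
  have hpos : 0 < orderOf a := orderOf_pos a
  have : NeZero (orderOf a) := ⟨hpos.ne'⟩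
  obtain ⟨t, -, htc, rfl⟩ := ((hprim ζ hζ).isPrimitiveRoot_iff).1 (hprim' ζ' hζ')
  obtain ⟨θ, hθa, hθ⟩ := aux_theta hp hG hR hm hn hc (hm ▸ htc)
  have hvan : ∀ g ∉ Subgroup.zpowers a, χ g = 0 := fun g hg => by
    rw [hχ]; exact aux_vanish ρ hirr hf hn hc hg
  have hvan' : ∀ g ∉ Subgroup.zpowers a, χ' g = 0 := fun g hg => by
    rw [hχ']; exact aux_vanish ρ' hirr' hf' hn hc hg
  have hpair := aux_pair χ χ' θ hθa hvan' S S' μ μ' hμ hμ' (fun i => by rw [hχ, hS])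
    (fun i => by rw [hχ', hS']) (fun η hη => (hprim η hη).pow_eq_one)
    (fun η hη => (hprim' η hη).pow_eq_one) hζ hζ'
  have hkey : ∀ g, χ (θ g) = χ' g := by
    intro g
    rw [hχ, hχ']
    refine aux_schur (ρ.comp θ.toMonoidHom) ρ' ?_ hirr' ?_ g
    · intro U hU
      apply hirr
      intro g x hx
      have := hU (θ.symm g) x hx
      simpa using this
    · simp only [hχ, hχ'] at hpair
      exact hpair
  obtain ⟨L, σ, hσ⟩ := aux_sigma hpos (hprim ζ hζ) htc
  choose hL hσ' using hσ
  have hsum : ∀ i : ℕ, ∃ h : algebraMap k E (χ (a ^ i)) ∈ L,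
      σ ⟨_, h⟩ = algebraMap k E (χ (a ^ (t * i))) := by
    intro i
    have hmem : ∀ η : S, (η : E) ∈ L := fun η => hL _ (hprim η η.2).pow_eq_one
    have e : algebraMap k E (χ (a ^ i)) =
        ((∑ η : S, (μ η : L) * ⟨η, hmem η⟩ ^ i : L) : E) := by
      rw [hχ, hS, ← Finset.sum_coe_sort]
      push_cast
      rfl
    refine ⟨e ▸ Subtype.property _, ?_⟩
    have e2 : (⟨algebraMap k E (χ (a ^ i)), e ▸ Subtype.property _⟩ : L) =
      ∑ η : S, (μ η : L) * ⟨η, hmem η⟩ ^ i := Subtype.ext e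
    rw [e2, map_sum, hχ, hS, ← Finset.sum_coe_sort S]
    apply Finset.sum_congr rfl
    intro η _
    rw [map_mul, map_natCast, map_pow, hσ' _ (hprim η η.2).pow_eq_one, ← pow_mul]
  have hall : ∀ x, ∃ h : algebraMap k E (χ x) ∈ L, σ ⟨_, h⟩ = algebraMap k E (χ (θ x)) := by
    intro x
    by_cases hx : x ∈ Subgroup.zpowers a
    · obtain ⟨i, rfl⟩ := mem_powers_iff_mem_zpowers.2 hx
      have := hsum i
      simp only [map_pow, hθa, ← pow_mul]
      exact this
    · rw [hvan _ (hθ x hx)]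
      have e : algebraMap k E (χ x) = 0 := by rw [hvan x hx, map_zero]
      refine ⟨e ▸ L.zero_mem, ?_⟩
      have e2 : (⟨algebraMap k E (χ x), e ▸ L.zero_mem⟩ : L) = 0 := Subtype.ext e
      rw [e2, map_zero, map_zero]
  choose hmemL hσL using hall
  obtain ⟨α, hα⟩ := aux_field (algebraMap k E) χ θ.toEquiv L σ hmemL hσL
  exact ⟨α, fun x => (hα x).trans (hkey x)⟩
end
end Genotype

namespace Genotype

/-- If `G` is a Roquette `p`-group, then the faithful `𝕂G`-irreps form a single Galois
conjugacy class: for any two faithful `𝕂G`-irreps `ψ, ψ'` there is a field automorphism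
`α` of the subfield `ℚ[ψ] ⊆ 𝕂` generated over `ℚ` by the character values of `ψ` with
`α (ψ g) = ψ' g` for all `g ∈ G`. -/
theorem faithful_irreps_single_galois_class (p : ℕ) (hp : p.Prime)
    (G : Type) [Group G] [Fintype G] (hG : IsPGroup p G)
    (k : Type) [Field k] [CharZero k] (hR : IsRoquette G)
    (ψ ψ' : FDRep k G) (hψ : IsIrr ψ) (hψf : IsFaithfulRep ψ)
    (hψ' : IsIrr ψ') (hψ'f : IsFaithfulRep ψ') :
    ∃ α : charField ψ.character ≃+* charField ψ.character,
      ∀ g : G, ((α ⟨ψ.character g, mem_charField _ g⟩ : charField ψ.character) : k)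
        = ψ'.character g := by
  have h1 := hψ.1
  have h2 := hψ'.1
  exact aux_main hp hG hR ψ.ρ ψ'.ρ hψ.2 hψ'.2 hψf hψ'f ψ.character ψ'.character
    (fun _ => rfl) (fun _ => rfl)

end Genotype
end
end
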